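/- arXiv:2103.06550 — 2 statements merged into one kernel-verified Lean document; each statement's English description precedes it below -/
import Mathlib

section
/- Let d ∈ ℕ, 0 < α < min(d,2), p > 2, and 0 < β < μ. Then there exists a constant c > 0 (depending only on d, α, p, β, μ) such that for every R > 1, with A_R := {x ∈ ℝ^d : 1/R < |x| < 1}: ∫_{A_R} ∫_{|y|≥1} | 1 − |y|^{β−μ} | · | |x|^{−(p−2)β} − |y|^{β−(p−1)μ} | · |x|^{−β} |y|^{−β} ν(x,y) dy dx ≤ c · max(1, R^{(p−1)β−d}, log R). -/
open MeasureTheory Real Filter Topology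
open scoped ENNReal NNReal

noncomputable section

/-- The signed power `a^⟨k⟩ := |a|^k sgn a` (with `0^k := 0`). -/
def sgnPow (a k : ℝ) : ℝ := |a| ^ k * Real.sign a

/-- The Bregman divergence `F_p(a,b) := |b|^p - |a|^p - p a^⟨p-1⟩ (b-a)`. -/
def bregmanF (p a b : ℝ) : ℝ := |b| ^ p - |a| ^ p - p * sgnPow a (p - 1) * (b - a)

/-- The constant `A_{d,-α} = 2^α Γ((d+α)/2) π^{-d/2} / |Γ(-α/2)|`. -/
def coefA (d : ℕ) (α : ℝ) : ℝ :=
  2 ^ α * Real.Gamma (((d : ℝ) + α) / 2) * Real.pi ^ (-(d : ℝ) / 2) / |Real.Gamma (-α / 2)|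

/-- The kernel `ν(x,y) = A_{d,-α} |x-y|^{-d-α}` of the fractional Laplacian. -/
def nuK (d : ℕ) (α : ℝ) (x y : EuclideanSpace ℝ (Fin d)) : ℝ :=
  coefA d α * ‖x - y‖ ^ (-(d : ℝ) - α)

/-- The Hardy constant `κ_β`.  Note that `Real.Gamma 0 = 0` and division by `0` is `0`
in Lean, so this formula automatically gives `κ_0 = 0` and `κ_{d-α} = 0`. -/
def kappaC (d : ℕ) (α β : ℝ) : ℝ :=
  2 ^ α * Real.Gamma ((β + α) / 2) * Real.Gamma (((d : ℝ) - β) / 2) /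
    (Real.Gamma (β / 2) * Real.Gamma (((d : ℝ) - β - α) / 2))

/-- The Sobolev–Bregman form `E_p[u]`, an element of `[0,∞]`
(the integrand is nonnegative). -/
def formEp (d : ℕ) (α p : ℝ) (u : EuclideanSpace ℝ (Fin d) → ℝ) : ℝ≥0∞ :=
  (1 / 2) * ∫⁻ x, ∫⁻ y, ENNReal.ofReal
    ((u x - u y) * (sgnPow (u x) (p - 1) - sgnPow (u y) (p - 1)) * nuK d α x y)

/-- The Hardy integral `∫ |u(x)|^p |x|^{-α} dx`, an element of `[0,∞]`. -/
def hardyI (d : ℕ) (α p : ℝ) (u : EuclideanSpace ℝ (Fin d) → ℝ) : ℝ≥0∞ :=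
  ∫⁻ x, ENNReal.ofReal (|u x| ^ p * ‖x‖ ^ (-α))

end

theorem one_sub_rpow_neg_le {s k : ℝ} (hs : 1 ≤ s) (hk : 0 ≤ k) :
    1 - s ^ (-k) ≤ k * (s - 1) := by
  have hs0 : 0 < s := by linarith
  have h1 := Real.add_one_le_exp (Real.log s * -k)
  have h2 := mul_le_mul_of_nonneg_left (Real.log_le_sub_one_of_pos hs0) hk
  rw [Real.rpow_def_of_pos hs0]
  linarith

theorem one_sub_rpow_le {r a : ℝ} (hr0 : 0 < r) (hr1 : r ≤ 1) :
    1 - r ^ a ≤ max a 1 * (1 - r) := by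
  rcases le_total 1 a with h | h
  · have := one_add_mul_self_le_rpow_one_add (s := r - 1) (by linarith) h
    rw [max_eq_left h]
    rw [add_sub_cancel] at this
    linarith
  · have := Real.rpow_le_rpow_of_exponent_ge hr0 hr1 h
    rw [max_eq_right h]
    rw [Real.rpow_one] at this
    linarith

theorem abs_rpow_sub_rpow_neg_le {r s t a b : ℝ} (hr0 : 0 < r) (hr1 : r ≤ 1) (hs : 1 ≤ s)
    (hst : s - r ≤ t) (ha : 0 ≤ a) (hb : 0 ≤ b) :
    |r ^ (-a) - s ^ (-b)| ≤ (max a 1 + b) * r ^ (-a) * min 1 t := by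
  have hs0 : 0 < s := by linarith
  have hra : 0 < r ^ a := Real.rpow_pos_of_pos hr0 a
  have hra1 : r ^ a ≤ 1 := Real.rpow_le_one hr0.le hr1 ha
  have hsb : 0 < s ^ (-b) := Real.rpow_pos_of_pos hs0 _
  have hsb1 : s ^ (-b) ≤ 1 := Real.rpow_le_one_of_one_le_of_nonpos hs (by linarith)
  have hrn : 0 < r ^ (-a) := Real.rpow_pos_of_pos hr0 _
  have hmul : r ^ (-a) * r ^ a = 1 := by
    rw [← Real.rpow_add hr0]; simp
  have hfac : r ^ (-a) - s ^ (-b) = r ^ (-a) * (1 - r ^ a * s ^ (-b)) := by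
    rw [mul_sub, ← mul_assoc, hmul]; ring
  have hC : 1 ≤ max a 1 := le_max_right _ _
  have hle : r ^ a * s ^ (-b) ≤ 1 := mul_le_one₀ hra1 hsb.le hsb1
  have key : 1 - r ^ a * s ^ (-b) ≤ (max a 1 + b) * min 1 t := by
    rcases min_cases (1 : ℝ) t with ⟨h, _⟩ | ⟨h, _⟩
    · rw [h]
      nlinarith [mul_pos hra hsb]
    · rw [h]
      have h1 := one_sub_rpow_le (a := a) hr0 hr1
      have h2 := one_sub_rpow_neg_le hs hb
      have h3 : r ^ a * (1 - s ^ (-b)) ≤ 1 - s ^ (-b) :=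
        mul_le_of_le_one_left (by linarith) hra1
      have h4 : max a 1 * (1 - r) ≤ max a 1 * t :=
        mul_le_mul_of_nonneg_left (by linarith) (by linarith)
      have h5 : b * (s - 1) ≤ b * t := mul_le_mul_of_nonneg_left (by linarith) hb
      linarith
  rw [hfac, abs_of_nonneg (mul_nonneg hrn.le (by linarith))]
  calc _ ≤ r ^ (-a) * ((max a 1 + b) * min 1 t) := mul_le_mul_of_nonneg_left key hrn.le
    _ = _ := by ring

theorem abs_one_sub_rpow_neg_le {s t k : ℝ} (hs : 1 ≤ s) (hst : s - 1 ≤ t) (hk : 0 ≤ k) :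
    |1 - s ^ (-k)| ≤ (1 + k) * min 1 t := by
  have h := abs_rpow_sub_rpow_neg_le (a := 0) one_pos le_rfl hs hst le_rfl hk
  simpa using h

theorem integrable_min_one_sq_mul_norm_rpow {E : Type*} [NormedAddCommGroup E] [NormedSpace ℝ E]
    [MeasurableSpace E] [BorelSpace E] [FiniteDimensional ℝ E] [Nontrivial E]
    (ν : Measure E) [ν.IsAddHaarMeasure] {α : ℝ} (hα0 : 0 < α) (hα2 : α < 2) :
    Integrable
      (fun z : E => min 1 ‖z‖ ^ 2 * ‖z‖ ^ (-(Module.finrank ℝ E : ℝ) - α)) ν := by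
  rw [integrable_fun_norm_addHaar ν
    (f := fun t : ℝ => min 1 t ^ 2 * t ^ (-(Module.finrank ℝ E : ℝ) - α))]
  have hd : 1 ≤ Module.finrank ℝ E := Module.finrank_pos
  have hpow : ∀ t : ℝ, 0 < t →
      t ^ (Module.finrank ℝ E - 1) * t ^ (-(Module.finrank ℝ E : ℝ) - α) = t ^ (-1 - α) := by
    intro t ht
    rw [← Real.rpow_natCast, ← Real.rpow_add ht]
    congr 1
    push_cast [hd]
    ring
  rw [← Set.Ioc_union_Ioi_eq_Ioi zero_le_one]
  refine IntegrableOn.union ?_ ?_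
  · have h : IntegrableOn (fun t : ℝ => t ^ (1 - α)) (Set.Ioc 0 1) :=
      (intervalIntegrable_iff_integrableOn_Ioc_of_le zero_le_one).1
        (intervalIntegral.intervalIntegrable_rpow' (by linarith))
    refine h.congr_fun (fun t ht => ?_) measurableSet_Ioc
    simp only [smul_eq_mul, min_eq_right ht.2]
    rw [mul_left_comm, hpow t ht.1, ← Real.rpow_natCast, ← Real.rpow_add ht.1]
    congr 1
    push_cast
    ring
  · refine (integrableOn_Ioi_rpow_of_lt (a := -1 - α) (by linarith) one_pos).congr_fun
      (fun t ht => ?_) measurableSet_Ioi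
    have ht' : (1 : ℝ) < t := ht
    simp only [smul_eq_mul, min_eq_left ht'.le]
    rw [one_pow, one_mul, hpow t (by linarith)]

theorem exists_integral_rpow_le (e : ℝ) :
    ∃ c : ℝ, 0 < c ∧ ∀ R : ℝ, 1 < R →
      ∫ t in (1 / R)..1, t ^ (e - 1) ≤ c * max (max 1 (R ^ (-e))) (Real.log R) := by
  have hmem : ∀ R : ℝ, 1 < R → (0 : ℝ) ∉ Set.uIcc (1 / R) 1 := fun R hR =>
    Set.notMem_uIcc_of_lt (by positivity) one_pos
  rcases eq_or_ne e 0 with rfl | he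
  · refine ⟨1, one_pos, fun R hR => ?_⟩
    have : ∫ t in (1 / R)..1, t ^ ((0 : ℝ) - 1) = Real.log R := by
      simp only [zero_sub, Real.rpow_neg_one]
      rw [integral_inv_of_pos (by positivity) one_pos]
      simp
    rw [this, one_mul]
    exact le_max_right _ _
  · refine ⟨1 / |e|, by positivity, fun R hR => ?_⟩
    have hR0 : 0 < R := by linarith
    rw [integral_rpow (Or.inr ⟨fun h => he (by linarith), hmem R hR⟩), sub_add_cancel,
      Real.one_rpow, one_div R, Real.inv_rpow hR0.le, ← Real.rpow_neg hR0.le]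
    have hpos := Real.rpow_pos_of_pos hR0 (-e)
    rcases lt_or_gt_of_ne he with h | h
    · rw [abs_of_neg h, ← neg_div_neg_eq, div_eq_inv_mul, ← one_div]
      refine mul_le_mul_of_nonneg_left ?_ (by rw [one_div_nonneg]; linarith)
      exact le_trans (by linarith) ((le_max_right _ _).trans (le_max_left _ _))
    · rw [abs_of_pos h, div_eq_inv_mul, ← one_div]
      refine mul_le_mul_of_nonneg_left ?_ (by positivity)
      exact le_trans (by linarith) ((le_max_left _ _).trans (le_max_left _ _))

theorem exists_lintegral_annulus_norm_rpow_le {E : Type*} [NormedAddCommGroup E]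
    [NormedSpace ℝ E] [MeasurableSpace E] [BorelSpace E] [FiniteDimensional ℝ E] [Nontrivial E]
    (ν : Measure E) [ν.IsAddHaarMeasure] (γ : ℝ) :
    ∃ c : ℝ, 0 < c ∧ ∀ R : ℝ, 1 < R →
      ∫⁻ x in {x : E | 1 / R < ‖x‖ ∧ ‖x‖ < 1}, ENNReal.ofReal (‖x‖ ^ (-γ)) ∂ν ≤
        ENNReal.ofReal (c * max (max 1 (R ^ (γ - Module.finrank ℝ E))) (Real.log R)) := by
  obtain ⟨c, hc, hcR⟩ := exists_integral_rpow_le ((Module.finrank ℝ E : ℝ) - γ)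
  have hd : 1 ≤ Module.finrank ℝ E := Module.finrank_pos
  set V : ℝ := Module.finrank ℝ E * ν.real (Metric.ball 0 1) with hV
  have hV0 : 0 ≤ V := by positivity
  refine ⟨(V + 1) * c, by positivity, fun R hR => ?_⟩
  have hR0 : 0 < 1 / R := by positivity
  have hR1 : 1 / R ≤ 1 := by rw [div_le_one (by linarith)]; exact hR.le
  set f : ℝ → ℝ := (Set.Ioo (1 / R) 1).indicator (fun t => t ^ (-γ)) with hf
  have hf0 : ∀ t, 0 ≤ f t := fun t =>
    Set.indicator_nonneg (fun t ht => Real.rpow_nonneg (hR0.trans ht.1).le _) t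
  have hmul : (fun t : ℝ => t ^ (Module.finrank ℝ E - 1) • f t) =
      (Set.Ioo (1 / R) 1).indicator (fun t => t ^ ((Module.finrank ℝ E : ℝ) - γ - 1)) := by
    funext t
    by_cases ht : t ∈ Set.Ioo (1 / R) 1
    · have ht0 : 0 < t := hR0.trans ht.1
      simp only [hf, Set.indicator_of_mem ht, smul_eq_mul]
      rw [← Real.rpow_natCast, ← Real.rpow_add ht0]
      congr 1
      push_cast [hd]
      ring
    · simp only [hf, Set.indicator_of_notMem ht, smul_zero]
  have hii : IntervalIntegrable (fun t : ℝ => t ^ ((Module.finrank ℝ E : ℝ) - γ - 1))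
      volume (1 / R) 1 :=
    intervalIntegral.intervalIntegrable_rpow (Or.inr (Set.notMem_uIcc_of_lt hR0 one_pos))
  have hint : Integrable (fun x : E => f ‖x‖) ν := by
    rw [integrable_fun_norm_addHaar ν (f := f), hmul]
    refine Integrable.integrableOn ?_
    rw [integrable_indicator_iff measurableSet_Ioo]
    exact ((intervalIntegrable_iff_integrableOn_Ioc_of_le hR1).1 hii).mono_set
      Set.Ioo_subset_Ioc_self
  have hset : MeasurableSet {x : E | 1 / R < ‖x‖ ∧ ‖x‖ < 1} :=
    (measurableSet_lt measurable_const measurable_norm).inter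
      (measurableSet_lt measurable_norm measurable_const)
  calc ∫⁻ x in {x : E | 1 / R < ‖x‖ ∧ ‖x‖ < 1}, ENNReal.ofReal (‖x‖ ^ (-γ)) ∂ν
      ≤ ∫⁻ x, ENNReal.ofReal (f ‖x‖) ∂ν := by
        refine le_trans (le_of_eq (setLIntegral_congr_fun hset fun x hx => ?_))
          (setLIntegral_le_lintegral _ _)
        simp only [hf, Set.indicator_of_mem (show ‖x‖ ∈ Set.Ioo (1 / R) 1 from hx)]
    _ = ENNReal.ofReal (∫ x, f ‖x‖ ∂ν) :=
        (ofReal_integral_eq_lintegral_ofReal hint (ae_of_all _ fun x => hf0 _)).symm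
    _ ≤ _ := by
        refine ENNReal.ofReal_le_ofReal ?_
        rw [integral_fun_norm_addHaar, hmul, setIntegral_indicator measurableSet_Ioo,
          Set.inter_eq_right.2 (Set.Ioo_subset_Ioi_self.trans (Set.Ioi_subset_Ioi hR0.le)),
          ← integral_Ioc_eq_integral_Ioo, ← intervalIntegral.integral_of_le hR1,
          nsmul_eq_mul, smul_eq_mul, ← mul_assoc, ← hV, mul_assoc]
        have h := hcR R hR
        rw [neg_sub] at h
        have h0 : 0 ≤ c * max (max 1 (R ^ (γ - Module.finrank ℝ E))) (Real.log R) :=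
          mul_nonneg hc.le (zero_le_one.trans ((le_max_left _ _).trans (le_max_left _ _)))
        nlinarith [mul_le_mul_of_nonneg_left h hV0]

/-- Bound for the auxiliary double integral over the annulus
`A_R = {1/R < |x| < 1}` times `{|y| ≥ 1}`. -/
theorem aux_integral_annulus_bound (d : ℕ) (α p β μ : ℝ)
    (hα0 : 0 < α) (hαd : α < d) (hα2 : α < 2) (hp : 2 < p)
    (hβ0 : 0 < β) (hβμ : β < μ) :
    ∃ c : ℝ, 0 < c ∧ ∀ R : ℝ, 1 < R →
      (∫⁻ x in {x : EuclideanSpace ℝ (Fin d) | 1 / R < ‖x‖ ∧ ‖x‖ < 1},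
        ∫⁻ y in {y : EuclideanSpace ℝ (Fin d) | 1 ≤ ‖y‖},
          ENNReal.ofReal (|1 - ‖y‖ ^ (β - μ)| *
            |‖x‖ ^ (-((p - 2) * β)) - ‖y‖ ^ (β - (p - 1) * μ)| *
            ‖x‖ ^ (-β) * ‖y‖ ^ (-β) * nuK d α x y))
        ≤ ENNReal.ofReal (c * max (max 1 (R ^ ((p - 1) * β - d))) (Real.log R)) := by
  have hd : 0 < d := by exact_mod_cast hα0.trans hαd
  have : Nonempty (Fin d) := ⟨⟨0, hd⟩⟩
  have hp2 : 0 ≤ (p - 2) * β := mul_nonneg (by linarith) hβ0.le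
  have hb : 0 ≤ (p - 1) * μ - β := by nlinarith
  set g : EuclideanSpace ℝ (Fin d) → ℝ :=
    fun z => min 1 ‖z‖ ^ 2 * ‖z‖ ^ (-(d : ℝ) - α) with hg
  have hg0 : ∀ z, 0 ≤ g z := fun z => by positivity
  have hgint : Integrable g := by
    simpa using integrable_min_one_sq_mul_norm_rpow
      (volume : Measure (EuclideanSpace ℝ (Fin d))) hα0 hα2
  set C : ℝ := (1 + (μ - β)) * (max ((p - 2) * β) 1 + ((p - 1) * μ - β)) * |coefA d α| with hC
  have hk : 0 ≤ μ - β := by linarith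
  have hC0 : 0 ≤ C := by positivity
  obtain ⟨c, hc, hcR⟩ := exists_lintegral_annulus_norm_rpow_le
    (volume : Measure (EuclideanSpace ℝ (Fin d))) ((p - 1) * β)
  have hI0 : 0 ≤ ∫ z, g z := integral_nonneg hg0
  refine ⟨(C * (∫ z, g z) + 1) * c, by positivity, fun R hR => ?_⟩
  have hR0 : 0 < 1 / R := by positivity
  have hset : MeasurableSet {x : EuclideanSpace ℝ (Fin d) | 1 / R < ‖x‖ ∧ ‖x‖ < 1} :=
    (measurableSet_lt measurable_const measurable_norm).inter
      (measurableSet_lt measurable_norm measurable_const)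
  have hset' : MeasurableSet {y : EuclideanSpace ℝ (Fin d) | 1 ≤ ‖y‖} :=
    measurableSet_le measurable_const measurable_norm
  have hpt : ∀ x y : EuclideanSpace ℝ (Fin d), 0 < ‖x‖ → ‖x‖ < 1 → 1 ≤ ‖y‖ →
      |1 - ‖y‖ ^ (β - μ)| * |‖x‖ ^ (-((p - 2) * β)) - ‖y‖ ^ (β - (p - 1) * μ)| *
        ‖x‖ ^ (-β) * ‖y‖ ^ (-β) * nuK d α x y ≤ C * ‖x‖ ^ (-((p - 1) * β)) * g (x - y) := by
    intro x y hx0 hx1 hy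
    have hxy : ‖y‖ - ‖x‖ ≤ ‖x - y‖ := by
      rw [norm_sub_rev]; exact norm_sub_norm_le y x
    have h1 := abs_one_sub_rpow_neg_le hy (by linarith : ‖y‖ - 1 ≤ ‖x - y‖) hk
    have h2 := abs_rpow_sub_rpow_neg_le hx0 hx1.le hy hxy hp2 hb
    rw [neg_sub] at h1 h2
    have h3 : ‖y‖ ^ (-β) ≤ 1 := Real.rpow_le_one_of_one_le_of_nonpos hy (by linarith)
    have h4 : nuK d α x y ≤ |coefA d α| * ‖x - y‖ ^ (-(d : ℝ) - α) :=
      mul_le_mul_of_nonneg_right (le_abs_self _) (by positivity)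
    have h5 : ‖x‖ ^ (-((p - 1) * β)) = ‖x‖ ^ (-((p - 2) * β)) * ‖x‖ ^ (-β) := by
      rw [← Real.rpow_add hx0]; congr 1; ring
    calc _ ≤ ((1 + (μ - β)) * min 1 ‖x - y‖) *
          ((max ((p - 2) * β) 1 + ((p - 1) * μ - β)) * ‖x‖ ^ (-((p - 2) * β)) *
            min 1 ‖x - y‖) * ‖x‖ ^ (-β) * 1 * (|coefA d α| * ‖x - y‖ ^ (-(d : ℝ) - α)) := by
          refine (mul_le_mul_of_nonneg_left h4 (by positivity)).trans ?_
          gcongr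
      _ = _ := by rw [h5, hC, hg]; ring
  have hinner : ∀ x ∈ {x : EuclideanSpace ℝ (Fin d) | 1 / R < ‖x‖ ∧ ‖x‖ < 1},
      (∫⁻ y in {y : EuclideanSpace ℝ (Fin d) | 1 ≤ ‖y‖},
          ENNReal.ofReal (|1 - ‖y‖ ^ (β - μ)| *
            |‖x‖ ^ (-((p - 2) * β)) - ‖y‖ ^ (β - (p - 1) * μ)| *
            ‖x‖ ^ (-β) * ‖y‖ ^ (-β) * nuK d α x y)) ≤
        ENNReal.ofReal (C * ∫ z, g z) * ENNReal.ofReal (‖x‖ ^ (-((p - 1) * β))) := by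
    intro x hx
    have hx0 : 0 < ‖x‖ := hR0.trans hx.1
    have hK : 0 ≤ C * ‖x‖ ^ (-((p - 1) * β)) := by positivity
    calc _ ≤ ∫⁻ y in {y : EuclideanSpace ℝ (Fin d) | 1 ≤ ‖y‖},
          ENNReal.ofReal (C * ‖x‖ ^ (-((p - 1) * β))) * ENNReal.ofReal (g (x - y)) := by
          refine setLIntegral_mono' hset' fun y hy => ?_
          rw [← ENNReal.ofReal_mul hK]
          exact ENNReal.ofReal_le_ofReal (hpt x y hx0 hx.2 hy)
      _ ≤ ∫⁻ y, ENNReal.ofReal (C * ‖x‖ ^ (-((p - 1) * β))) * ENNReal.ofReal (g (x - y)) :=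
          setLIntegral_le_lintegral _ _
      _ = ENNReal.ofReal (C * ‖x‖ ^ (-((p - 1) * β))) * ENNReal.ofReal (∫ z, g z) := by
          rw [lintegral_const_mul' _ _ ENNReal.ofReal_ne_top,
            lintegral_sub_left_eq_self (fun z => ENNReal.ofReal (g z)) x,
            ofReal_integral_eq_lintegral_ofReal hgint (ae_of_all _ hg0)]
      _ = _ := by
          rw [← ENNReal.ofReal_mul hK, ← ENNReal.ofReal_mul (mul_nonneg hC0 hI0),
            mul_right_comm]
  have h := hcR R hR
  rw [finrank_euclideanSpace_fin] at h
  refine (setLIntegral_mono' hset hinner).trans ?_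
  rw [lintegral_const_mul' _ _ ENNReal.ofReal_ne_top]
  refine (mul_le_mul_right h _).trans ?_
  rw [← ENNReal.ofReal_mul (mul_nonneg hC0 hI0)]
  refine ENNReal.ofReal_le_ofReal ?_
  have h0 : 0 ≤ c * max (max 1 (R ^ ((p - 1) * β - d))) (Real.log R) :=
    mul_nonneg hc.le (zero_le_one.trans ((le_max_left _ _).trans (le_max_left _ _)))
  nlinarith
end

section
/- Let d ∈ ℕ, 0 < α < min(d,2), p > 2, and κ > κ_{(d−α)/p}. Then there exists a nonnegative function f ∈ C_c^∞(ℝ^d) such that E_p[f] < κ ∫_{ℝ^d} |f(x)|^p |x|^{−α} dx < ∞. -/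
open MeasureTheory Real Filter Topology
open scoped ENNReal NNReal

open Set in
theorem integral_Ioo_rpow_mul_one_sub_rpow {u v : ℝ} (hu : 0 < u) (hv : 0 < v) :
    IntegrableOn (fun x : ℝ => x ^ (u - 1) * (1 - x) ^ (v - 1)) (Ioo 0 1) ∧
    ∫ x in Ioo (0 : ℝ) 1, x ^ (u - 1) * (1 - x) ^ (v - 1) = Gamma u * Gamma v / Gamma (u + v) := by
  have hB := ProbabilityTheory.beta_pos hu hv
  have h1 := ProbabilityTheory.lintegral_betaPDF_eq_one hu hv
  rw [ProbabilityTheory.lintegral_betaPDF] at h1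
  set B := ProbabilityTheory.beta u v with hBdef
  have hmeas : Measurable (fun x : ℝ => 1 / B * x ^ (u - 1) * (1 - x) ^ (v - 1)) := by fun_prop
  have hnn : 0 ≤ᵐ[volume.restrict (Ioo (0 : ℝ) 1)]
      fun x : ℝ => 1 / B * x ^ (u - 1) * (1 - x) ^ (v - 1) := by
    refine ae_restrict_of_forall_mem measurableSet_Ioo fun x hx => ?_
    have := hx.1
    have : 0 < 1 - x := by linarith [hx.2]
    simp only [Pi.zero_apply]
    positivity
  have hint : IntegrableOn (fun x : ℝ => 1 / B * x ^ (u - 1) * (1 - x) ^ (v - 1)) (Ioo 0 1) := by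
    refine ⟨hmeas.aestronglyMeasurable, ?_⟩
    rw [hasFiniteIntegral_iff_ofReal hnn, h1]
    exact ENNReal.one_lt_top
  have hval : ∫ x in Ioo (0 : ℝ) 1, 1 / B * x ^ (u - 1) * (1 - x) ^ (v - 1) = 1 := by
    rw [integral_eq_lintegral_of_nonneg_ae hnn hmeas.aestronglyMeasurable, h1]
    simp
  simp_rw [mul_assoc] at hint hval
  constructor
  · have := hint.const_mul B
    refine this.congr (Eventually.of_forall fun x => ?_)
    simp only
    field_simp
  · rw [integral_const_mul] at hval
    have : B ≠ 0 := hB.ne'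
    field_simp at hval
    rw [hval]
    rfl

/-- The truncated power defect `1 - (1 - τ)₊ ^ (a - 1)`. -/
noncomputable def powDefect (a τ : ℝ) : ℝ := 1 - if τ < 1 then (1 - τ) ^ (a - 1) else 0

theorem measurable_powDefect (a : ℝ) : Measurable (powDefect a) := by
  unfold powDefect
  refine measurable_const.sub (Measurable.ite measurableSet_Iio ?_ measurable_const)
  fun_prop

open Set in
theorem one_sub_rpow_le_mul {a τ : ℝ} (h0 : 0 < τ) (h1 : τ < 1) :
    1 - (1 - τ) ^ a ≤ max a 1 * τ := by
  rcases le_total 1 a with h | h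
  · have := one_add_mul_self_le_rpow_one_add (s := -τ) (by linarith) h
    rw [max_eq_left h]
    rw [← sub_eq_add_neg] at this
    linarith
  · rw [max_eq_right h]
    have := rpow_le_rpow_of_exponent_ge (x := 1 - τ) (by linarith) (by linarith) h
    rw [rpow_one] at this
    linarith

open Set in
theorem integral_Ioo_rpow_mul_one_sub_one_sub_rpow {σ a : ℝ} (hσ1 : σ < 1)
    (ha : 0 < a) :
    IntegrableOn (fun τ : ℝ => τ ^ (-σ - 1) * (1 - (1 - τ) ^ a)) (Ioo 0 1) ∧
    σ * ∫ τ in Ioo (0 : ℝ) 1, τ ^ (-σ - 1) * (1 - (1 - τ) ^ a) =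
      a * (Gamma (1 - σ) * Gamma a / Gamma (1 - σ + a)) - 1 := by
  obtain ⟨hBi, hBv⟩ := integral_Ioo_rpow_mul_one_sub_rpow (sub_pos.2 hσ1) ha
  have hexp : 1 - σ - 1 = -σ := by ring
  rw [hexp] at hBi hBv
  have hlow : ∀ τ ∈ Ioo (0 : ℝ) 1, 0 ≤ 1 - (1 - τ) ^ a := fun τ hτ => by
    have := rpow_le_one (x := 1 - τ) (z := a) (by linarith [hτ.2]) (by linarith [hτ.1]) ha.le
    linarith
  have hpow : IntegrableOn (fun τ : ℝ => τ ^ (-σ)) (Ioo 0 1) := by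
    have := (intervalIntegral.intervalIntegrable_rpow' (a := 0) (b := 1) (r := -σ) (by linarith))
    rw [intervalIntegrable_iff_integrableOn_Ioo_of_le zero_le_one] at this
    exact this
  have hint : IntegrableOn (fun τ : ℝ => τ ^ (-σ - 1) * (1 - (1 - τ) ^ a)) (Ioo 0 1) := by
    refine Integrable.mono' (hpow.const_mul (max a 1))
      (Measurable.aestronglyMeasurable (by fun_prop)) ?_
    refine ae_restrict_of_forall_mem measurableSet_Ioo fun τ hτ => ?_
    have hτ0 : 0 < τ := hτ.1
    rw [norm_of_nonneg (mul_nonneg (rpow_nonneg hτ0.le _) (hlow τ hτ))]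
    calc τ ^ (-σ - 1) * (1 - (1 - τ) ^ a) ≤ τ ^ (-σ - 1) * (max a 1 * τ) := by
          gcongr
          exact one_sub_rpow_le_mul hτ.1 hτ.2
      _ = max a 1 * τ ^ (-σ) := by
          rw [rpow_sub_one hτ0.ne']
          field_simp
  refine ⟨hint, ?_⟩
  have hF : ∀ x ∈ Ioo (0 : ℝ) 1, HasDerivAt (fun τ : ℝ => τ ^ (-σ) * (1 - (1 - τ) ^ a))
      (-σ * (x ^ (-σ - 1) * (1 - (1 - x) ^ a)) + a * (x ^ (-σ) * (1 - x) ^ (a - 1))) x := by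
    intro x hx
    have h1 := Real.hasDerivAt_rpow_const (x := x) (p := -σ) (Or.inl hx.1.ne')
    have h2 : HasDerivAt (fun τ : ℝ => 1 - (1 - τ) ^ a) (a * (1 - x) ^ (a - 1)) x := by
      have := (((hasDerivAt_id x).const_sub 1).rpow_const (p := a)
        (Or.inl (by simp only [id]; linarith [hx.2]))).const_sub 1
      refine this.congr_deriv ?_
      simp
    refine (h1.mul h2).congr_deriv ?_
    ring
  have hFi : IntegrableOn (fun x : ℝ => -σ * (x ^ (-σ - 1) * (1 - (1 - x) ^ a))
      + a * (x ^ (-σ) * (1 - x) ^ (a - 1))) (Ioo 0 1) :=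
    (hint.const_mul _).add (hBi.const_mul _)
  have hlim0 : Tendsto (fun τ : ℝ => τ ^ (-σ) * (1 - (1 - τ) ^ a)) (𝓝[>] 0) (𝓝 0) := by
    have hup : Tendsto (fun τ : ℝ => max a 1 * τ ^ (1 - σ)) (𝓝[>] 0) (𝓝 0) := by
      have : Continuous (fun τ : ℝ => max a 1 * τ ^ (1 - σ)) :=
        continuous_const.mul (Real.continuous_rpow_const (by linarith))
      have h := (this.tendsto 0).mono_left (nhdsWithin_le_nhds (s := Ioi 0))
      rwa [zero_rpow (by linarith), mul_zero] at h
    refine squeeze_zero' ?_ ?_ hup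
    · filter_upwards [Ioo_mem_nhdsGT (zero_lt_one' ℝ)] with τ hτ
      exact mul_nonneg (rpow_nonneg hτ.1.le _) (hlow τ hτ)
    · filter_upwards [Ioo_mem_nhdsGT (zero_lt_one' ℝ)] with τ hτ
      have hτ0 : 0 < τ := hτ.1
      calc τ ^ (-σ) * (1 - (1 - τ) ^ a) ≤ τ ^ (-σ) * (max a 1 * τ) := by
            gcongr
            exact one_sub_rpow_le_mul hτ.1 hτ.2
        _ = max a 1 * τ ^ (1 - σ) := by
            rw [sub_eq_neg_add, rpow_add_one hτ0.ne']
            ring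
  have hlim1 : Tendsto (fun τ : ℝ => τ ^ (-σ) * (1 - (1 - τ) ^ a)) (𝓝[<] 1) (𝓝 1) := by
    have h1 : ContinuousAt (fun τ : ℝ => τ ^ (-σ)) 1 :=
      Real.continuousAt_rpow_const 1 (-σ) (Or.inl one_ne_zero)
    have h2 : ContinuousAt (fun τ : ℝ => 1 - (1 - τ) ^ a) 1 := by
      have : Continuous (fun τ : ℝ => 1 - (1 - τ) ^ a) :=
        continuous_const.sub ((Real.continuous_rpow_const ha.le).comp
          (continuous_const.sub continuous_id))
      exact this.continuousAt
    have h := (h1.mul h2).tendsto.mono_left (nhdsWithin_le_nhds (s := Iio 1))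
    simp only [Pi.mul_apply, one_rpow, sub_self, zero_rpow ha.ne', sub_zero, one_mul] at h
    exact h
  have hftc := intervalIntegral.integral_eq_sub_of_hasDerivAt_of_tendsto zero_lt_one hF
    ((intervalIntegrable_iff_integrableOn_Ioo_of_le zero_le_one).2 hFi) hlim0 hlim1
  rw [intervalIntegral.integral_of_le zero_le_one, integral_Ioc_eq_integral_Ioo,
    integral_add (hint.const_mul _) (hBi.const_mul _), integral_const_mul, integral_const_mul,
    hBv] at hftc
  linarith

open Set in
theorem integral_Ioi_rpow_mul_powDefect {σ a : ℝ} (hσ0 : 0 < σ) (hσ1 : σ < 1) (haσ : σ ≤ a) :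
    IntegrableOn (fun τ : ℝ => τ ^ (-σ - 1) * powDefect a τ) (Ioi 0) ∧
    ∫ τ in Ioi (0 : ℝ), τ ^ (-σ - 1) * powDefect a τ =
      Gamma (1 - σ) / σ * (Gamma a / Gamma (a - σ)) := by
  have ha : 0 < a := hσ0.trans_le haσ
  obtain ⟨hBi, hBv⟩ := integral_Ioo_rpow_mul_one_sub_rpow (sub_pos.2 hσ1) ha
  have hexp : 1 - σ - 1 = -σ := by ring
  rw [hexp] at hBi hBv
  obtain ⟨hDi, hDv⟩ := integral_Ioo_rpow_mul_one_sub_one_sub_rpow hσ1 ha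
  have heq : EqOn (fun τ : ℝ => τ ^ (-σ - 1) * (1 - (1 - τ) ^ a) - τ ^ (-σ) * (1 - τ) ^ (a - 1))
      (fun τ : ℝ => τ ^ (-σ - 1) * powDefect a τ) (Ioo 0 1) := by
    intro τ hτ
    have hτ0 : 0 < τ := hτ.1
    have hτ1 : 0 < 1 - τ := by linarith [hτ.2]
    simp only [powDefect, if_pos hτ.2]
    have e1 : (1 - τ) ^ a = (1 - τ) ^ (a - 1) * (1 - τ) := by
      rw [← rpow_add_one hτ1.ne']; congr 1; ring
    have e2 : τ ^ (-σ) = τ ^ (-σ - 1) * τ := by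
      rw [← rpow_add_one hτ0.ne']; congr 1; ring
    rw [e1, e2]
    ring
  have heq2 : EqOn (fun τ : ℝ => τ ^ (-σ - 1))
      (fun τ : ℝ => τ ^ (-σ - 1) * powDefect a τ) (Ioi 1) := by
    intro τ hτ
    have : ¬ τ < 1 := not_lt.2 (le_of_lt hτ)
    simp [powDefect, if_neg this]
  have hi1 : IntegrableOn (fun τ : ℝ => τ ^ (-σ - 1) * powDefect a τ) (Ioc 0 1) := by
    rw [integrableOn_Ioc_iff_integrableOn_Ioo]
    exact (hDi.sub hBi).congr_fun heq measurableSet_Ioo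
  have hi2 : IntegrableOn (fun τ : ℝ => τ ^ (-σ - 1) * powDefect a τ) (Ioi 1) :=
    (integrableOn_Ioi_rpow_of_lt (by linarith) one_pos).congr_fun heq2 measurableSet_Ioi
  have hun : Ioc (0 : ℝ) 1 ∪ Ioi 1 = Ioi 0 := Ioc_union_Ioi_eq_Ioi zero_le_one
  refine ⟨hun ▸ hi1.union hi2, ?_⟩
  rw [← hun, setIntegral_union (Ioc_disjoint_Ioi le_rfl) measurableSet_Ioi hi1 hi2,
    integral_Ioc_eq_integral_Ioo, ← setIntegral_congr_fun measurableSet_Ioo heq,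
    ← setIntegral_congr_fun measurableSet_Ioi heq2, integral_sub hDi hBi, hBv,
    integral_Ioi_rpow_of_lt (by linarith) one_pos]
  have hD : ∫ τ in Ioo (0 : ℝ) 1, τ ^ (-σ - 1) * (1 - (1 - τ) ^ a) =
      (a * (Gamma (1 - σ) * Gamma a / Gamma (1 - σ + a)) - 1) / σ := by
    rw [← hDv]; field_simp
  rw [hD, one_rpow]
  have hG : (a - σ) / Gamma (1 - σ + a) = 1 / Gamma (a - σ) := by
    rcases eq_or_lt_of_le haσ with h | h
    · rw [h]; simp
    · have : 1 - σ + a = (a - σ) + 1 := by ring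
      rw [this, Gamma_add_one (by linarith)]
      have := (Gamma_pos_of_pos (sub_pos.2 h)).ne'
      have := (sub_pos.2 h).ne'
      field_simp
  have hs : -σ - 1 + 1 = -σ := by ring
  rw [hs]
  calc _ = Gamma (1 - σ) / σ * (Gamma a * ((a - σ) / Gamma (1 - σ + a))) := by
        field_simp
        ring
    _ = _ := by rw [hG]; ring

open Set in
theorem integral_Ioi_rpow_mul_comp_div {σ v : ℝ} (hv : 0 < v) {f : ℝ → ℝ}
    (hf : IntegrableOn (fun τ : ℝ => τ ^ (-σ - 1) * f τ) (Ioi 0)) :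
    IntegrableOn (fun t : ℝ => t ^ (σ - 1) * f (v / t)) (Ioi 0) ∧
    ∫ t in Ioi (0 : ℝ), t ^ (σ - 1) * f (v / t) =
      v ^ σ * ∫ τ in Ioi (0 : ℝ), τ ^ (-σ - 1) * f τ := by
  have heq : EqOn (fun x : ℝ => (|(-1 : ℝ)| * x ^ ((-1 : ℝ) - 1)) •
      ((fun τ : ℝ => τ ^ (-σ - 1) * f τ) (x ^ (-1 : ℝ))))
      (fun x : ℝ => x ^ (σ - 1) * f (1 / x)) (Ioi 0) := by
    intro x hx
    have hx0 : (0 : ℝ) < x := hx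
    simp only [abs_neg, abs_one, one_mul, smul_eq_mul]
    rw [← rpow_mul hx0.le, ← mul_assoc, ← rpow_add hx0, rpow_neg_one, one_div]
    congr 2
    ring
  have h1 : IntegrableOn (fun x : ℝ => x ^ (σ - 1) * f (1 / x)) (Ioi 0) :=
    ((integrableOn_Ioi_comp_rpow_iff _ (by norm_num : (-1 : ℝ) ≠ 0)).2 hf).congr_fun heq
      measurableSet_Ioi
  have h2 : ∫ x in Ioi (0 : ℝ), x ^ (σ - 1) * f (1 / x) =
      ∫ τ in Ioi (0 : ℝ), τ ^ (-σ - 1) * f τ := by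
    rw [← setIntegral_congr_fun measurableSet_Ioi heq]
    exact integral_comp_rpow_Ioi (fun τ : ℝ => τ ^ (-σ - 1) * f τ) (by norm_num : (-1 : ℝ) ≠ 0)
  have heq2 : EqOn (fun t : ℝ => v ^ (σ - 1) * ((v⁻¹ * t) ^ (σ - 1) * f (1 / (v⁻¹ * t))))
      (fun t : ℝ => t ^ (σ - 1) * f (v / t)) (Ioi 0) := by
    intro t ht
    have ht0 : (0 : ℝ) < t := ht
    simp only
    rw [mul_rpow (by positivity) ht0.le, inv_rpow hv.le]
    have : v ^ (σ - 1) ≠ 0 := (rpow_pos_of_pos hv _).ne'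
    have e : 1 / (v⁻¹ * t) = v / t := by field_simp
    rw [e]
    field_simp
  have hvi : 0 < v⁻¹ := inv_pos.2 hv
  constructor
  · refine IntegrableOn.congr_fun ?_ heq2 measurableSet_Ioi
    have h3 := (integrableOn_Ioi_comp_mul_left_iff
      (fun x : ℝ => x ^ (σ - 1) * f (1 / x)) 0 hvi).2 (by rwa [mul_zero])
    exact Integrable.const_mul h3 _
  · rw [← setIntegral_congr_fun measurableSet_Ioi heq2, integral_const_mul,
      integral_comp_mul_left_Ioi (fun x : ℝ => x ^ (σ - 1) * f (1 / x)) 0 hvi, mul_zero, h2,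
      smul_eq_mul, inv_inv, ← mul_assoc, ← rpow_add_one hv.ne']
    congr 2
    ring

open Set in
theorem integrable_gamma_mul_powDefect {g σ a : ℝ} (hg : 0 < g) (hσ0 : 0 < σ) (hσ1 : σ < 1)
    (haσ : σ ≤ a) :
    Integrable (fun q : ℝ × ℝ => q.1 ^ (g - 1) * exp (-q.1) *
      (q.2 ^ (σ - 1) * powDefect a (q.1 / q.2)))
      ((volume.restrict (Ioi 0)).prod (volume.restrict (Ioi 0))) := by
  obtain ⟨hk, -⟩ := integral_Ioi_rpow_mul_powDefect hσ0 hσ1 haσ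
  have hmeas : Measurable (fun q : ℝ × ℝ => q.1 ^ (g - 1) * exp (-q.1) *
      (q.2 ^ (σ - 1) * powDefect a (q.1 / q.2))) := by
    have := measurable_powDefect a
    fun_prop
  rw [integrable_prod_iff hmeas.aestronglyMeasurable]
  have hkn : IntegrableOn (fun τ : ℝ => τ ^ (-σ - 1) * |powDefect a τ|) (Ioi 0) := by
    refine IntegrableOn.congr_fun (Integrable.norm hk) (fun τ hτ => ?_) measurableSet_Ioi
    have : (0 : ℝ) ≤ τ ^ (-σ - 1) := rpow_nonneg (le_of_lt hτ) _
    simp [abs_of_nonneg this]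
  constructor
  · refine ae_restrict_of_forall_mem measurableSet_Ioi fun v hv => ?_
    exact Integrable.const_mul (integral_Ioi_rpow_mul_comp_div hv hk).1 (v ^ (g - 1) * exp (-v))
  · have hG := (Real.GammaIntegral_convergent (add_pos hg hσ0)).mul_const
      (∫ τ in Ioi (0 : ℝ), τ ^ (-σ - 1) * |powDefect a τ|)
    refine IntegrableOn.congr_fun hG (fun v hv => ?_) measurableSet_Ioi
    have hv0 : (0 : ℝ) < v := hv
    have heq : EqOn (fun t : ℝ => ‖v ^ (g - 1) * exp (-v) * (t ^ (σ - 1) * powDefect a (v / t))‖)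
        (fun t : ℝ => v ^ (g - 1) * exp (-v) * (t ^ (σ - 1) * |powDefect a (v / t)|)) (Ioi 0) := by
      intro t ht
      have h1 : (0 : ℝ) ≤ t ^ (σ - 1) := rpow_nonneg (le_of_lt ht) _
      have h2 := rpow_nonneg hv0.le (g - 1)
      simp only [norm_mul, norm_eq_abs, abs_of_nonneg h1, abs_of_nonneg h2, abs_exp]
    simp only
    rw [setIntegral_congr_fun measurableSet_Ioi heq, integral_const_mul,
      (integral_Ioi_rpow_mul_comp_div hv hkn).2]
    have : g + σ - 1 = g - 1 + σ := by ring
    rw [this, rpow_add hv0]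
    ring

/-- The `Gamma(g)`-weighted average of the truncated power defect at scale `t`. -/
noncomputable def gammaDefect (g a t : ℝ) : ℝ :=
  ∫ v in Set.Ioi (0 : ℝ), v ^ (g - 1) * exp (-v) * powDefect a (v / t)

open Set in
theorem integral_rpow_mul_gammaDefect {g σ a : ℝ} (hg : 0 < g) (hσ0 : 0 < σ) (hσ1 : σ < 1)
    (haσ : σ ≤ a) :
    IntegrableOn (fun t : ℝ => t ^ (σ - 1) * gammaDefect g a t) (Ioi 0) ∧
    ∫ t in Ioi (0 : ℝ), t ^ (σ - 1) * gammaDefect g a t =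
      Gamma (g + σ) * (Gamma (1 - σ) / σ * (Gamma a / Gamma (a - σ))) := by
  have hI := integrable_gamma_mul_powDefect hg hσ0 hσ1 haσ
  obtain ⟨hk, hkv⟩ := integral_Ioi_rpow_mul_powDefect hσ0 hσ1 haσ
  have heq : ∀ t : ℝ, ∫ v in Ioi (0 : ℝ), v ^ (g - 1) * exp (-v) *
      (t ^ (σ - 1) * powDefect a (v / t)) = t ^ (σ - 1) * gammaDefect g a t := by
    intro t
    rw [gammaDefect, ← integral_const_mul]
    congr 1
    ext v
    ring
  constructor
  · have := hI.integral_prod_right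
    simp only [heq] at this
    exact this
  · simp_rw [← heq]
    rw [← integral_integral_swap (f := fun v t : ℝ => v ^ (g - 1) * exp (-v) *
      (t ^ (σ - 1) * powDefect a (v / t))) hI, Gamma_eq_integral (add_pos hg hσ0),
      ← integral_mul_const]
    refine setIntegral_congr_fun measurableSet_Ioi fun v hv => ?_
    have hv0 : (0 : ℝ) < v := hv
    rw [integral_const_mul, (integral_Ioi_rpow_mul_comp_div hv hk).2, hkv]
    have : g + σ - 1 = g - 1 + σ := by ring
    rw [this, rpow_add hv0]
    ring

open Set in
theorem ae_lintegral_gamma_mul_trunc {g σ a : ℝ} (hg : 0 < g) (hσ0 : 0 < σ) (hσ1 : σ < 1)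
    (haσ : σ ≤ a) :
    ∀ᵐ t ∂(volume.restrict (Ioi (0 : ℝ))),
      ∫⁻ v in Ioi (0 : ℝ), ENNReal.ofReal (v ^ (g - 1) * exp (-v) * (1 - powDefect a (v / t))) =
        ENNReal.ofReal (Gamma g - gammaDefect g a t) ∧ 0 ≤ Gamma g - gammaDefect g a t := by
  have hI := (integrable_gamma_mul_powDefect hg hσ0 hσ1 haσ).prod_left_ae
  filter_upwards [hI, ae_restrict_mem measurableSet_Ioi] with t ht ht0
  have ht0 : (0 : ℝ) < t := ht0
  have hd : IntegrableOn (fun v : ℝ => v ^ (g - 1) * exp (-v) * powDefect a (v / t)) (Ioi 0) := by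
    have := ht.mul_const (t ^ (σ - 1))⁻¹
    refine this.congr (Eventually.of_forall fun v => ?_)
    have : t ^ (σ - 1) ≠ 0 := (rpow_pos_of_pos ht0 _).ne'
    simp only
    field_simp
  have hG : IntegrableOn (fun v : ℝ => v ^ (g - 1) * exp (-v)) (Ioi 0) := by
    simpa [mul_comm] using Real.GammaIntegral_convergent hg
  have hval : ∫ v in Ioi (0 : ℝ), v ^ (g - 1) * exp (-v) * (1 - powDefect a (v / t)) =
      Gamma g - gammaDefect g a t := by
    rw [gammaDefect, Gamma_eq_integral hg]
    have : ∫ v in Ioi (0 : ℝ), exp (-v) * v ^ (g - 1) = ∫ v in Ioi (0 : ℝ), v ^ (g - 1) * exp (-v) := by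
      simp_rw [mul_comm]
    rw [this, ← integral_sub hG hd]
    congr 1
    ext v
    ring
  have hnn : ∀ v ∈ Ioi (0 : ℝ), 0 ≤ v ^ (g - 1) * exp (-v) * (1 - powDefect a (v / t)) := by
    intro v hv
    have hv0 : (0 : ℝ) < v := hv
    have : 0 ≤ 1 - powDefect a (v / t) := by
      rw [powDefect, sub_sub_cancel]
      split_ifs with h
      · exact rpow_nonneg (by linarith) _
      · exact le_rfl
    positivity
  rw [← hval]
  refine ⟨(ofReal_integral_eq_lintegral_ofReal ?_
    (ae_restrict_of_forall_mem measurableSet_Ioi hnn)).symm,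
    setIntegral_nonneg measurableSet_Ioi hnn⟩
  refine (hG.sub hd).congr (Eventually.of_forall fun v => ?_)
  simp only [Pi.sub_apply]
  ring

theorem lintegral_exp_neg_mul_sq_norm_sub {d : ℕ} {e : EuclideanSpace ℝ (Fin d)} (he : ‖e‖ = 1)
    {s t : ℝ} (hs : 0 < s) (ht : 0 < t) :
    ∫⁻ z : EuclideanSpace ℝ (Fin d), ENNReal.ofReal (exp (-(s * ‖z‖ ^ 2)) * exp (-(t * ‖e - z‖ ^ 2)))
      = ENNReal.ofReal ((π / (s + t)) ^ ((d : ℝ) / 2) * exp (-(s * t / (s + t)))) := by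
  have hst : 0 < s + t := add_pos hs ht
  have hpt : ∀ z : EuclideanSpace ℝ (Fin d),
      exp (-(s * ‖z‖ ^ 2)) * exp (-(t * ‖e - z‖ ^ 2)) =
        exp (-(s + t) * ‖z - (t / (s + t)) • e‖ ^ 2) * exp (-(s * t / (s + t))) := by
    intro z
    rw [← exp_add, ← exp_add, norm_sub_sq_real, norm_sub_sq_real, norm_smul, he,
      inner_smul_right, real_inner_comm e z, norm_of_nonneg (by positivity)]
    congr 1
    field_simp
    ring
  have hg : ∫ z : EuclideanSpace ℝ (Fin d), exp (-(s + t) * ‖z‖ ^ 2) =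
      (π / (s + t)) ^ ((d : ℝ) / 2) := by
    rw [GaussianFourier.integral_rexp_neg_mul_sq_norm hst, finrank_euclideanSpace_fin]
  have hpos : 0 < (π / (s + t)) ^ ((d : ℝ) / 2) := by positivity
  have hi : Integrable (fun z : EuclideanSpace ℝ (Fin d) => exp (-(s + t) * ‖z‖ ^ 2)) := by
    by_contra h
    rw [integral_undef h] at hg
    exact hpos.ne hg
  have hi' := (hi.comp_sub_right ((t / (s + t)) • e)).mul_const (exp (-(s * t / (s + t))))
  simp_rw [hpt]
  rw [← ofReal_integral_eq_lintegral_ofReal hi' (Eventually.of_forall fun z => by positivity),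
    integral_mul_const, integral_sub_right_eq_self
      (fun z : EuclideanSpace ℝ (Fin d) => exp (-(s + t) * ‖z‖ ^ 2)), hg]

theorem ofReal_rpow_neg_eq_lintegral {g r : ℝ} (hg : 0 < g) (hr : 0 < r) :
    ENNReal.ofReal (r ^ (-(2 * g))) =
      ENNReal.ofReal (1 / Gamma g) *
        ∫⁻ s in Set.Ioi (0 : ℝ), ENNReal.ofReal (s ^ (g - 1) * exp (-(s * r ^ 2))) := by
  have h2 : 0 < r ^ 2 := by positivity
  have hv := Real.integral_rpow_mul_exp_neg_mul_Ioi hg h2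
  have hG := Gamma_pos_of_pos hg
  have hi : IntegrableOn (fun s : ℝ => s ^ (g - 1) * exp (-(r ^ 2 * s))) (Set.Ioi 0) := by
    by_contra h
    rw [integral_undef h] at hv
    exact (by positivity : 0 < (1 / r ^ 2) ^ g * Gamma g).ne hv
  simp_rw [mul_comm _ (r ^ 2)]
  rw [← ofReal_integral_eq_lintegral_ofReal hi
    (ae_restrict_of_forall_mem measurableSet_Ioi fun s hs =>
      mul_nonneg (rpow_nonneg (le_of_lt hs) _) (exp_pos _).le), hv,
    ← ENNReal.ofReal_mul (by positivity)]
  congr 1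
  rw [rpow_neg hr.le, rpow_mul hr.le, one_div, one_div, inv_rpow h2.le, rpow_two]
  field_simp

open Set in
theorem lintegral_Ioi_comp_mul_div_add {t : ℝ} (ht : 0 < t) (F : ℝ → ℝ≥0∞) :
    ∫⁻ s in Ioi (0 : ℝ), F s =
      ∫⁻ v in Ioo 0 t, ENNReal.ofReal (t ^ 2 / (t - v) ^ 2) * F (v * t / (t - v)) := by
  have himg : (fun v : ℝ => v * t / (t - v)) '' Ioo 0 t = Ioi 0 := by
    ext s
    simp only [mem_image, mem_Ioi, mem_Ioo]
    constructor
    · rintro ⟨v, ⟨h0, h1⟩, rfl⟩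
      have := sub_pos.2 h1
      positivity
    · intro hs
      have hst : 0 < s + t := add_pos hs ht
      refine ⟨s * t / (s + t), ⟨by positivity, ?_⟩, ?_⟩
      · rw [div_lt_iff₀ hst]
        nlinarith
      · have : t - s * t / (s + t) = t ^ 2 / (s + t) := by field_simp; ring
        rw [this]
        field_simp
  have hder : ∀ v ∈ Ioo (0 : ℝ) t,
      HasDerivWithinAt (fun v : ℝ => v * t / (t - v)) (t ^ 2 / (t - v) ^ 2) (Ioo 0 t) v := by
    intro v hv
    have hne : t - v ≠ 0 := (sub_pos.2 hv.2).ne'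
    have := ((hasDerivAt_id v).mul_const t).div ((hasDerivAt_id v).const_sub t) hne
    refine (this.congr_deriv ?_).hasDerivWithinAt
    simp only [id]
    congr 1
    ring
  have hinj : InjOn (fun v : ℝ => v * t / (t - v)) (Ioo 0 t) := by
    intro v hv w hw h
    have h1 : t - v ≠ 0 := (sub_pos.2 hv.2).ne'
    have h2 : t - w ≠ 0 := (sub_pos.2 hw.2).ne'
    simp only at h
    rw [div_eq_div_iff h1 h2] at h
    have : t ^ 2 * (v - w) = 0 := by linear_combination h
    rcases mul_eq_zero.1 this with h | h
    · exact absurd h (by positivity)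
    · linarith
  rw [← himg, lintegral_image_eq_lintegral_abs_deriv_mul measurableSet_Ioo hder hinj]
  refine setLIntegral_congr_fun measurableSet_Ioo fun v hv => ?_
  rw [abs_of_nonneg (by positivity)]

open Set in
theorem lintegral_norm_rpow_mul_gaussian {d : ℕ} {e : EuclideanSpace ℝ (Fin d)} (he : ‖e‖ = 1)
    {γ t : ℝ} (hγ : 0 < γ) (ht : 0 < t) :
    ∫⁻ z : EuclideanSpace ℝ (Fin d), ENNReal.ofReal (‖z‖ ^ (-γ) * exp (-(t * ‖e - z‖ ^ 2))) =
      ENNReal.ofReal ((π / t) ^ ((d : ℝ) / 2) / Gamma (γ / 2)) *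
        ∫⁻ v in Ioi (0 : ℝ), ENNReal.ofReal
          (v ^ (γ / 2 - 1) * exp (-v) * (1 - powDefect (((d : ℝ) - γ) / 2) (v / t))) := by
  have hg : 0 < γ / 2 := by positivity
  have hG := Gamma_pos_of_pos hg
  have hne : ∀ᵐ z : EuclideanSpace ℝ (Fin d), z ≠ 0 := by
    have : Nontrivial (EuclideanSpace ℝ (Fin d)) :=
      ⟨⟨e, 0, by rintro rfl; simp at he⟩⟩
    exact Measure.ae_ne volume 0
  have h1 : ∀ᵐ z : EuclideanSpace ℝ (Fin d),
      ENNReal.ofReal (‖z‖ ^ (-γ) * exp (-(t * ‖e - z‖ ^ 2))) =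
        ENNReal.ofReal (1 / Gamma (γ / 2)) * ∫⁻ s in Ioi (0 : ℝ),
          ENNReal.ofReal (s ^ (γ / 2 - 1) * exp (-(s * ‖z‖ ^ 2)) * exp (-(t * ‖e - z‖ ^ 2))) := by
    filter_upwards [hne] with z hz
    have hr : 0 < ‖z‖ := norm_pos_iff.2 hz
    have := ofReal_rpow_neg_eq_lintegral hg hr
    rw [ENNReal.ofReal_mul (by positivity)]
    rw [show -γ = -(2 * (γ / 2)) by ring, this, mul_assoc]
    congr 1
    rw [← lintegral_mul_const _ (by fun_prop)]
    refine setLIntegral_congr_fun measurableSet_Ioi fun s hs => ?_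
    rw [ENNReal.ofReal_mul (mul_nonneg (rpow_nonneg (le_of_lt hs) _) (exp_pos _).le)]
  rw [lintegral_congr_ae h1, lintegral_const_mul' _ _ ENNReal.ofReal_ne_top,
    lintegral_lintegral_swap]
  swap
  · apply Measurable.aemeasurable
    unfold Function.uncurry
    fun_prop
  have h2 : ∫⁻ s in Ioi (0 : ℝ), ∫⁻ z : EuclideanSpace ℝ (Fin d),
      ENNReal.ofReal (s ^ (γ / 2 - 1) * exp (-(s * ‖z‖ ^ 2)) * exp (-(t * ‖e - z‖ ^ 2))) =
      ∫⁻ s in Ioi (0 : ℝ), ENNReal.ofReal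
        (s ^ (γ / 2 - 1) * ((π / (s + t)) ^ ((d : ℝ) / 2) * exp (-(s * t / (s + t))))) := by
    refine setLIntegral_congr_fun measurableSet_Ioi fun s hs => ?_
    have hp : 0 ≤ s ^ (γ / 2 - 1) := rpow_nonneg (le_of_lt hs) _
    simp_rw [mul_assoc, ENNReal.ofReal_mul hp]
    rw [lintegral_const_mul' _ _ ENNReal.ofReal_ne_top, lintegral_exp_neg_mul_sq_norm_sub he hs ht,
      ENNReal.ofReal_mul (by have := add_pos hs ht; positivity)]
  rw [h2, lintegral_Ioi_comp_mul_div_add ht]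
  have h3 : ∫⁻ v in Ioi (0 : ℝ), ENNReal.ofReal
          (v ^ (γ / 2 - 1) * exp (-v) * (1 - powDefect (((d : ℝ) - γ) / 2) (v / t))) =
      ∫⁻ v in Ioo (0 : ℝ) t, ENNReal.ofReal
          (v ^ (γ / 2 - 1) * exp (-v) * (1 - v / t) ^ (((d : ℝ) - γ) / 2 - 1)) := by
    rw [← lintegral_indicator measurableSet_Ioi, ← lintegral_indicator measurableSet_Ioo]
    congr 1
    ext v
    by_cases h0 : 0 < v
    · by_cases hv : v < t
      · have : v / t < 1 := (div_lt_one ht).2 hv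
        simp [indicator, powDefect, *]
      · have : ¬ v / t < 1 := by rwa [div_lt_one ht]
        simp [indicator, powDefect, *]
    · simp [indicator, h0]
  rw [h3, ← lintegral_const_mul' _ _ ENNReal.ofReal_ne_top,
    ← lintegral_const_mul' _ _ ENNReal.ofReal_ne_top]
  refine setLIntegral_congr_fun measurableSet_Ioo fun v hv => ?_
  obtain ⟨h0, hvt⟩ := hv
  have hvt' : 0 < t - v := sub_pos.2 hvt
  have h1v : 0 < 1 - v / t := by rw [sub_pos, div_lt_one ht]; exact hvt
  rw [← ENNReal.ofReal_mul (by positivity), ← ENNReal.ofReal_mul (by positivity),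
    ← ENNReal.ofReal_mul (by positivity)]
  congr 1
  set c := 1 - v / t with hc
  have e0 : t - v = t * c := by rw [hc]; field_simp
  have e1 : v * t / (t - v) = v / c := by rw [e0]; field_simp
  have e2 : v * t / (t - v) + t = t / c := by
    rw [e1]
    have : v = t * (1 - c) := by rw [hc]; field_simp; ring
    rw [this]
    field_simp
    ring
  have e3 : v * t / (t - v) * t / (v * t / (t - v) + t) = v := by
    rw [e2, e1]; field_simp
  have e4 : t ^ 2 / (t - v) ^ 2 = c ^ (-2 : ℝ) := by
    rw [e0, rpow_neg h1v.le, rpow_two]; field_simp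
  have e5 : (π / (t / c)) ^ ((d : ℝ) / 2) = (π / t) ^ ((d : ℝ) / 2) * c ^ ((d : ℝ) / 2) := by
    rw [← mul_rpow (by positivity) h1v.le]; congr 1; field_simp
  have e6 : (v / c) ^ (γ / 2 - 1) = v ^ (γ / 2 - 1) * c ^ (-(γ / 2 - 1)) := by
    rw [div_rpow h0.le h1v.le, rpow_neg h1v.le]; rfl
  have e7 : c ^ (((d : ℝ) - γ) / 2 - 1) = c ^ (-2 : ℝ) * c ^ (-(γ / 2 - 1)) * c ^ ((d : ℝ) / 2) := by
    rw [← rpow_add h1v, ← rpow_add h1v]; congr 1; ring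
  rw [e3, e2, e1, e4, e5, e6, e7]
  ring

open Set in
theorem ae_integral_norm_rpow_mul_gaussian {d : ℕ} {e : EuclideanSpace ℝ (Fin d)} (he : ‖e‖ = 1)
    {α γ : ℝ} (hα0 : 0 < α) (hα2 : α < 2) (hγ : 0 < γ) (hγd : γ ≤ d - α) :
    ∀ᵐ t ∂(volume.restrict (Ioi (0 : ℝ))),
      Integrable (fun z : EuclideanSpace ℝ (Fin d) =>
        ‖z‖ ^ (-γ) * exp (-(t * ‖e - z‖ ^ 2))) ∧
      ∫ z : EuclideanSpace ℝ (Fin d), ‖z‖ ^ (-γ) * exp (-(t * ‖e - z‖ ^ 2)) =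
        (π / t) ^ ((d : ℝ) / 2) *
          (1 - gammaDefect (γ / 2) (((d : ℝ) - γ) / 2) t / Gamma (γ / 2)) := by
  have hg : 0 < γ / 2 := by positivity
  have hG := Gamma_pos_of_pos hg
  filter_upwards [ae_lintegral_gamma_mul_trunc (σ := α / 2) (a := ((d : ℝ) - γ) / 2) hg
    (by positivity) (by linarith) (by linarith), ae_restrict_mem measurableSet_Ioi] with t ht ht0
  obtain ⟨hv, hnn⟩ := ht
  have ht0 : (0 : ℝ) < t := ht0
  have hL := lintegral_norm_rpow_mul_gaussian he hγ ht0
  rw [hv, ← ENNReal.ofReal_mul (by positivity)] at hL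
  have hmeas : AEStronglyMeasurable (fun z : EuclideanSpace ℝ (Fin d) =>
      ‖z‖ ^ (-γ) * exp (-(t * ‖e - z‖ ^ 2))) := Measurable.aestronglyMeasurable (by fun_prop)
  have hpos : 0 ≤ᵐ[volume] (fun z : EuclideanSpace ℝ (Fin d) =>
      ‖z‖ ^ (-γ) * exp (-(t * ‖e - z‖ ^ 2))) := Eventually.of_forall fun z => by
    simp only [Pi.zero_apply]; positivity
  refine ⟨⟨hmeas, ?_⟩, ?_⟩
  · rw [hasFiniteIntegral_iff_ofReal hpos, hL]
    exact ENNReal.ofReal_lt_top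
  · rw [integral_eq_lintegral_of_nonneg_ae hpos hmeas, hL, ENNReal.toReal_ofReal (by positivity)]
    field_simp

theorem integral_gaussian_sub {d : ℕ} (e : EuclideanSpace ℝ (Fin d)) {t : ℝ} (ht : 0 < t) :
    Integrable (fun z : EuclideanSpace ℝ (Fin d) => exp (-(t * ‖e - z‖ ^ 2))) ∧
    ∫ z : EuclideanSpace ℝ (Fin d), exp (-(t * ‖e - z‖ ^ 2)) = (π / t) ^ ((d : ℝ) / 2) := by
  have hg : ∫ z : EuclideanSpace ℝ (Fin d), exp (-(t * ‖e - z‖ ^ 2)) =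
      (π / t) ^ ((d : ℝ) / 2) := by
    rw [integral_sub_left_eq_self (fun z : EuclideanSpace ℝ (Fin d) => exp (-(t * ‖z‖ ^ 2)))]
    simp_rw [← neg_mul]
    rw [GaussianFourier.integral_rexp_neg_mul_sq_norm ht, finrank_euclideanSpace_fin]
  refine ⟨?_, hg⟩
  by_contra h
  rw [integral_undef h] at hg
  exact (by positivity : 0 < (π / t) ^ ((d : ℝ) / 2)).ne hg

theorem one_sub_rpow_neg_mul_nonneg {r β β' : ℝ} (hr : 0 < r) (hβ : 0 < β) (hβ' : 0 < β') :
    0 ≤ (1 - r ^ (-β)) * (1 - r ^ (-β')) := by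
  rcases le_total 1 r with h | h
  · have h1 := rpow_le_one_of_one_le_of_nonpos h (neg_nonpos.2 hβ.le)
    have h2 := rpow_le_one_of_one_le_of_nonpos h (neg_nonpos.2 hβ'.le)
    exact mul_nonneg (by linarith) (by linarith)
  · have h1 := one_le_rpow_of_pos_of_le_one_of_nonpos hr h (neg_nonpos.2 hβ.le)
    have h2 := one_le_rpow_of_pos_of_le_one_of_nonpos hr h (neg_nonpos.2 hβ'.le)
    exact mul_nonneg_of_nonpos_of_nonpos (by linarith) (by linarith)

theorem kappaC_nonneg {d : ℕ} {α β : ℝ} (hα0 : 0 < α) (hβ : 0 < β) (hβd : β < d - α) :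
    0 ≤ kappaC d α β := by
  have h1 := Gamma_pos_of_pos (s := (β + α) / 2) (by positivity)
  have h2 := Gamma_pos_of_pos (s := ((d : ℝ) - β) / 2) (by linarith)
  have h3 := Gamma_pos_of_pos (s := β / 2) (by positivity)
  have h4 := Gamma_pos_of_pos (s := ((d : ℝ) - β - α) / 2) (by linarith)
  unfold kappaC
  positivity

open Set in
theorem lintegral_one_sub_rpow_mul_nuK {d : ℕ} {e : EuclideanSpace ℝ (Fin d)} (he : ‖e‖ = 1)
    {α β β' : ℝ} (hα0 : 0 < α) (hα2 : α < 2) (hβ : 0 < β) (hβ' : 0 < β') (hsum : β + β' = d - α) :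
    ∫⁻ z : EuclideanSpace ℝ (Fin d),
      ENNReal.ofReal ((1 - ‖z‖ ^ (-β)) * (1 - ‖z‖ ^ (-β')) * nuK d α e z) =
        ENNReal.ofReal (2 * kappaC d α β) := by
  set D : EuclideanSpace ℝ (Fin d) → ℝ := fun z => (1 - ‖z‖ ^ (-β)) * (1 - ‖z‖ ^ (-β')) with hD
  have hDm : Measurable D := by fun_prop
  have hd : (0 : ℝ) < d := by linarith
  have hnt : Nontrivial (EuclideanSpace ℝ (Fin d)) := ⟨⟨e, 0, by rintro rfl; simp at he⟩⟩
  have hne0 : ∀ᵐ z : EuclideanSpace ℝ (Fin d), z ≠ 0 := Measure.ae_ne volume 0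
  have hnee : ∀ᵐ z : EuclideanSpace ℝ (Fin d), z ≠ e := Measure.ae_ne volume e
  have hDnn : ∀ᵐ z : EuclideanSpace ℝ (Fin d), 0 ≤ D z := by
    filter_upwards [hne0] with z hz
    exact one_sub_rpow_neg_mul_nonneg (norm_pos_iff.2 hz) hβ hβ'
  have hg : 0 < ((d : ℝ) + α) / 2 := by positivity
  have hGg := Gamma_pos_of_pos hg
  have hσ0 : 0 < α / 2 := by positivity
  have hσ1 : α / 2 < 1 := by linarith
  have hGσ : |Gamma (-α / 2)| = Gamma (1 - α / 2) / (α / 2) := by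
    have h := Real.Gamma_add_one (s := -α / 2) (by linarith)
    have e1 : -α / 2 + 1 = 1 - α / 2 := by ring
    rw [e1] at h
    have hp := Gamma_pos_of_pos (sub_pos.2 hσ1)
    have hneg : Gamma (-α / 2) < 0 := by
      by_contra hc
      nlinarith [mul_nonneg hσ0.le (not_lt.1 hc)]
    rw [abs_of_neg hneg, h]
    field_simp
  have hGσ' : 0 < Gamma (1 - α / 2) := Gamma_pos_of_pos (sub_pos.2 hσ1)
  have hc : coefA d α / Gamma (((d : ℝ) + α) / 2) =
      2 ^ α * π ^ (-(d : ℝ) / 2) / (Gamma (1 - α / 2) / (α / 2)) := by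
    unfold coefA
    rw [hGσ]
    field_simp
  have hcpos : 0 ≤ coefA d α / Gamma (((d : ℝ) + α) / 2) := by rw [hc]; positivity
  have h1 : ∀ᵐ z : EuclideanSpace ℝ (Fin d), ENNReal.ofReal (D z * nuK d α e z) =
      ENNReal.ofReal (coefA d α / Gamma (((d : ℝ) + α) / 2)) * ∫⁻ t in Ioi (0 : ℝ),
        ENNReal.ofReal (t ^ (((d : ℝ) + α) / 2 - 1) * (D z * exp (-(t * ‖e - z‖ ^ 2)))) := by
    filter_upwards [hDnn, hnee] with z hz hze
    have hr : 0 < ‖e - z‖ := norm_pos_iff.2 (sub_ne_zero.2 hze.symm)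
    have h := ofReal_rpow_neg_eq_lintegral hg hr
    have e1 : D z * nuK d α e z = (coefA d α / Gamma (((d : ℝ) + α) / 2)) *
        (Gamma (((d : ℝ) + α) / 2) * D z * ‖e - z‖ ^ (-(2 * (((d : ℝ) + α) / 2)))) := by
      unfold nuK
      have : -(d : ℝ) - α = -(2 * (((d : ℝ) + α) / 2)) := by ring
      rw [this]
      field_simp
    rw [e1, ENNReal.ofReal_mul hcpos, ENNReal.ofReal_mul (by positivity), h]
    have e2 : Gamma (((d : ℝ) + α) / 2) * D z * (1 / Gamma (((d : ℝ) + α) / 2)) = D z := by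
      field_simp
    congr 1
    rw [← mul_assoc, ← ENNReal.ofReal_mul (by positivity), e2,
      ← lintegral_const_mul' _ _ ENNReal.ofReal_ne_top]
    refine lintegral_congr fun t => ?_
    rw [← ENNReal.ofReal_mul hz]
    congr 1
    ring
  rw [lintegral_congr_ae h1, lintegral_const_mul' _ _ ENNReal.ofReal_ne_top,
    lintegral_lintegral_swap]
  swap
  · apply Measurable.aemeasurable
    unfold Function.uncurry
    fun_prop
  set N : ℝ → ℝ → ℝ := fun γ t =>
    gammaDefect (γ / 2) (((d : ℝ) - γ) / 2) t / Gamma (γ / 2) with hN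
  set S : ℝ → ℝ := fun t => N β t + N β' t - N (d - α) t with hS
  have hNint : ∀ γ, 0 < γ → γ ≤ d - α →
      IntegrableOn (fun t : ℝ => t ^ (α / 2 - 1) * N γ t) (Ioi 0) ∧
      ∫ t in Ioi (0 : ℝ), t ^ (α / 2 - 1) * N γ t =
        Gamma (1 - α / 2) / (α / 2) * (Gamma ((γ + α) / 2) * Gamma (((d : ℝ) - γ) / 2) /
          (Gamma (γ / 2) * Gamma (((d : ℝ) - γ - α) / 2))) := by
    intro γ h0 h1
    obtain ⟨hi, hv⟩ := integral_rpow_mul_gammaDefect (g := γ / 2) (a := ((d : ℝ) - γ) / 2)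
      (by positivity) hσ0 hσ1 (by linarith)
    have e0 : (fun t : ℝ => t ^ (α / 2 - 1) * N γ t) = fun t =>
        t ^ (α / 2 - 1) * gammaDefect (γ / 2) (((d : ℝ) - γ) / 2) t * (Gamma (γ / 2))⁻¹ := by
      ext t
      simp only [hN]
      ring
    rw [e0]
    refine ⟨Integrable.mul_const hi _, ?_⟩
    rw [integral_mul_const, hv]
    have e1 : γ / 2 + α / 2 = (γ + α) / 2 := by ring
    have e2 : ((d : ℝ) - γ) / 2 - α / 2 = ((d : ℝ) - γ - α) / 2 := by ring
    rw [e1, e2]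
    simp only [div_eq_mul_inv, mul_inv]
    ring
  have h2 : ∀ᵐ t ∂(volume.restrict (Ioi (0 : ℝ))), (∫⁻ z : EuclideanSpace ℝ (Fin d),
      ENNReal.ofReal (t ^ (((d : ℝ) + α) / 2 - 1) * (D z * exp (-(t * ‖e - z‖ ^ 2))))) =
        ENNReal.ofReal (π ^ ((d : ℝ) / 2) * (t ^ (α / 2 - 1) * S t)) ∧ 0 ≤ t ^ (α / 2 - 1) * S t := by
    filter_upwards [ae_integral_norm_rpow_mul_gaussian he hα0 hα2 hβ (by linarith),
      ae_integral_norm_rpow_mul_gaussian he hα0 hα2 hβ' (by linarith),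
      ae_integral_norm_rpow_mul_gaussian (γ := d - α) he hα0 hα2 (by linarith) le_rfl,
      ae_restrict_mem measurableSet_Ioi] with t ⟨i1, v1⟩ ⟨i2, v2⟩ ⟨i3, v3⟩ ht
    have ht : (0 : ℝ) < t := ht
    obtain ⟨i0, v0⟩ := integral_gaussian_sub e ht
    have hDe : (fun z => D z * exp (-(t * ‖e - z‖ ^ 2))) =ᵐ[volume] fun z =>
        exp (-(t * ‖e - z‖ ^ 2)) - ‖z‖ ^ (-β) * exp (-(t * ‖e - z‖ ^ 2))
          - ‖z‖ ^ (-β') * exp (-(t * ‖e - z‖ ^ 2))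
          + ‖z‖ ^ (-((d : ℝ) - α)) * exp (-(t * ‖e - z‖ ^ 2)) := by
      filter_upwards [hne0] with z hz
      have e1 : ‖z‖ ^ (-((d : ℝ) - α)) = ‖z‖ ^ (-β) * ‖z‖ ^ (-β') := by
        rw [← rpow_add (norm_pos_iff.2 hz)]; congr 1; linarith
      rw [e1, hD]
      ring
    have i01 : Integrable (fun z : EuclideanSpace ℝ (Fin d) => exp (-(t * ‖e - z‖ ^ 2)) -
        ‖z‖ ^ (-β) * exp (-(t * ‖e - z‖ ^ 2))) := i0.sub i1
    have i02 : Integrable (fun z : EuclideanSpace ℝ (Fin d) => exp (-(t * ‖e - z‖ ^ 2)) -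
        ‖z‖ ^ (-β) * exp (-(t * ‖e - z‖ ^ 2)) - ‖z‖ ^ (-β') * exp (-(t * ‖e - z‖ ^ 2))) :=
      i01.sub i2
    have hi : Integrable (fun z => D z * exp (-(t * ‖e - z‖ ^ 2))) :=
      (i02.add i3).congr hDe.symm
    have hv : ∫ z, D z * exp (-(t * ‖e - z‖ ^ 2)) = (π / t) ^ ((d : ℝ) / 2) * S t := by
      rw [integral_congr_ae hDe, integral_add i02 i3, integral_sub i01 i2,
        integral_sub i0 i1, v0, v1, v2, v3]
      simp only [hS, hN]
      ring
    have hnn : 0 ≤ᵐ[volume] fun z => D z * exp (-(t * ‖e - z‖ ^ 2)) := by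
      filter_upwards [hDnn] with z hz
      exact mul_nonneg hz (exp_pos _).le
    have hSnn : 0 ≤ S t := by
      have h := integral_nonneg_of_ae hnn
      rw [hv] at h
      exact nonneg_of_mul_nonneg_right h (by positivity)
    refine ⟨?_, mul_nonneg (rpow_nonneg ht.le _) hSnn⟩
    simp_rw [ENNReal.ofReal_mul (rpow_nonneg ht.le (((d : ℝ) + α) / 2 - 1))]
    rw [lintegral_const_mul' _ _ ENNReal.ofReal_ne_top,
      ← ofReal_integral_eq_lintegral_ofReal hi hnn, hv, ← ENNReal.ofReal_mul (by positivity)]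
    congr 1
    have e1 : ((d : ℝ) + α) / 2 - 1 = (α / 2 - 1) + (d : ℝ) / 2 := by ring
    rw [e1, rpow_add ht, div_rpow pi_pos.le ht.le]
    have : t ^ ((d : ℝ) / 2) ≠ 0 := (rpow_pos_of_pos ht _).ne'
    field_simp
  obtain ⟨j1, w1⟩ := hNint β hβ (by linarith)
  obtain ⟨j2, w2⟩ := hNint β' hβ' (by linarith)
  obtain ⟨j3, w3⟩ := hNint (d - α) (by linarith) le_rfl
  have hSe : (fun t : ℝ => t ^ (α / 2 - 1) * S t) = fun t =>
      t ^ (α / 2 - 1) * N β t + t ^ (α / 2 - 1) * N β' t - t ^ (α / 2 - 1) * N (d - α) t := by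
    ext t
    simp only [hS]
    ring
  have j12 : Integrable (fun t : ℝ => t ^ (α / 2 - 1) * N β t + t ^ (α / 2 - 1) * N β' t)
      (volume.restrict (Ioi 0)) := Integrable.add j1 j2
  have hSi : Integrable (fun t : ℝ => t ^ (α / 2 - 1) * S t) (volume.restrict (Ioi 0)) := by
    rw [hSe]
    exact j12.sub j3
  have hSv : ∫ t in Ioi (0 : ℝ), t ^ (α / 2 - 1) * S t =
      Gamma (1 - α / 2) / (α / 2) * (2 * (Gamma ((β + α) / 2) * Gamma (((d : ℝ) - β) / 2) /
          (Gamma (β / 2) * Gamma (((d : ℝ) - β - α) / 2)))) := by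
    rw [hSe, integral_sub j12 j3, integral_add j1 j2, w1, w2, w3]
    have a1 : (β' + α) / 2 = ((d : ℝ) - β) / 2 := by linarith
    have a2 : ((d : ℝ) - β') / 2 = (β + α) / 2 := by linarith
    have a3 : β' / 2 = ((d : ℝ) - β - α) / 2 := by linarith
    have a4 : ((d : ℝ) - β' - α) / 2 = β / 2 := by linarith
    have a5 : ((d : ℝ) - (d - α) - α) / 2 = 0 := by ring
    rw [a1, a2, a3, a4, a5, Gamma_zero]
    simp only [div_eq_mul_inv, mul_inv]
    ring
  rw [lintegral_congr_ae (h2.mono fun t ht => ht.1)]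
  simp_rw [ENNReal.ofReal_mul (rpow_nonneg pi_pos.le ((d : ℝ) / 2))]
  rw [lintegral_const_mul' _ _ ENNReal.ofReal_ne_top,
    ← ofReal_integral_eq_lintegral_ofReal hSi (h2.mono fun t ht => ht.2), hSv,
    ← ENNReal.ofReal_mul (by positivity), ← ENNReal.ofReal_mul hcpos, hc]
  congr 1
  have hpi : π ^ (-(d : ℝ) / 2) * π ^ ((d : ℝ) / 2) = 1 := by
    rw [← rpow_add pi_pos, neg_div, neg_add_cancel, rpow_zero]
  unfold kappaC
  calc _ = 2 * (2 ^ α * (π ^ (-(d : ℝ) / 2) * π ^ ((d : ℝ) / 2)) *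
        (Gamma ((β + α) / 2) * Gamma (((d : ℝ) - β) / 2) /
          (Gamma (β / 2) * Gamma (((d : ℝ) - β - α) / 2)))) := by
        have hG : Gamma (1 - α / 2) / (α / 2) ≠ 0 := by positivity
        generalize Gamma (1 - α / 2) / (α / 2) = G at hG ⊢
        field_simp
    _ = _ := by
        rw [hpi]
        ring

theorem exists_two_mul_sub_sub_le_mul_sq {ψ : ℝ → ℝ} (h1 : ContDiff ℝ 2 ψ)
    (h2 : HasCompactSupport ψ) :
    ∃ M : ℝ, 0 ≤ M ∧ ∀ r s, 2 * ψ r - ψ (r + s) - ψ (r - s) ≤ M * s ^ 2 := by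
  have hd : ContDiff ℝ 1 (deriv ψ) := by
    have h : ContDiff ℝ (1 + 1) ψ := by simpa [one_add_one_eq_two] using h1
    exact (contDiff_succ_iff_deriv.1 h).2.2
  obtain ⟨K, hK⟩ := ContDiff.lipschitzWith_of_hasCompactSupport h2.deriv hd one_ne_zero
  have hdiff : Differentiable ℝ ψ := h1.differentiable two_ne_zero
  refine ⟨K, K.2, fun r s => ?_⟩
  have key : ∀ s, 0 ≤ s → 2 * ψ r - ψ (r + s) - ψ (r - s) ≤ K * s ^ 2 := by
    intro s hs
    have hder : ∀ t, HasDerivAt (fun t => K * t ^ 2 + ψ (r + t) + ψ (r - t))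
        (2 * K * t + deriv ψ (r + t) - deriv ψ (r - t)) t := by
      intro t
      have d1 : HasDerivAt (fun t => ψ (r + t)) (deriv ψ (r + t)) t := by
        simpa using (hdiff (r + t)).hasDerivAt.comp_const_add r t
      have d2 : HasDerivAt (fun t => ψ (r - t)) (-deriv ψ (r - t)) t := by
        simpa using (hdiff (r - t)).hasDerivAt.comp_const_sub r t
      have d3 : HasDerivAt (fun t : ℝ => (K : ℝ) * t ^ 2) (2 * K * t) t :=
        ((hasDerivAt_pow 2 t).const_mul (K : ℝ)).congr_deriv (by norm_num; ring)
      exact ((d3.add d1).add d2).congr_deriv (by ring)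
    have hmono : MonotoneOn (fun t => K * t ^ 2 + ψ (r + t) + ψ (r - t)) (Set.Ici 0) := by
      refine monotoneOn_of_deriv_nonneg (convex_Ici 0)
        (fun t _ => (hder t).continuousAt.continuousWithinAt)
        (fun t _ => (hder t).differentiableAt.differentiableWithinAt) fun t ht => ?_
      rw [interior_Ici, Set.mem_Ioi] at ht
      rw [(hder t).deriv]
      have h := hK.dist_le_mul (r + t) (r - t)
      rw [Real.dist_eq, Real.dist_eq, show r + t - (r - t) = 2 * t by ring,
        abs_of_pos (by positivity : 0 < 2 * t)] at h
      linarith [neg_abs_le (deriv ψ (r + t) - deriv ψ (r - t))]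
    have h := hmono Set.self_mem_Ici (Set.mem_Ici.2 hs) hs
    simp only [add_zero, sub_zero] at h
    nlinarith
  rcases le_total 0 s with hs | hs
  · exact key s hs
  · have h := key (-s) (by linarith)
    rw [← sub_eq_add_neg, sub_neg_eq_add, neg_sq] at h
    linarith

theorem integrable_rpow_mul_comp {q : ℝ} (hq : 0 < q) {h k : ℝ → ℝ} (hc : Continuous h)
    (hs : HasCompactSupport h) (hk : Continuous k) :
    Integrable (fun r => h r ^ q * k r) := by
  have h1 : HasCompactSupport (fun r => h r ^ q) :=
    hs.comp_left (g := fun x : ℝ => x ^ q) (zero_rpow hq.ne')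
  exact ((hc.rpow_const fun _ => Or.inr hq.le).mul hk).integrable_of_hasCompactSupport h1.mul_right

theorem integral_rpow_mul_sub_le {q M : ℝ} (hq : 0 < q) {h : ℝ → ℝ} (hc : Continuous h)
    (hs : HasCompactSupport h) (h0 : ∀ r, 0 ≤ h r) (heven : ∀ r, h (-r) = h r)
    (hM : ∀ r s, 2 * h r - h (r + s) - h (r - s) ≤ M * s ^ 2) (s : ℝ) :
    (∫ r, h r ^ q * h r) - ∫ r, h r ^ q * h (r + s) ≤ M / 2 * s ^ 2 * ∫ r, h r ^ q := by
  have i0 := integrable_rpow_mul_comp hq hc hs hc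
  have i1 := integrable_rpow_mul_comp hq hc hs (k := fun r => h (r + s)) (by fun_prop)
  have i2 := integrable_rpow_mul_comp hq hc hs (k := fun r => h (r - s)) (by fun_prop)
  have i3 := integrable_rpow_mul_comp hq hc hs (k := fun _ => M / 2 * s ^ 2) (by fun_prop)
  have hsym : ∫ r, h r ^ q * h (r - s) = ∫ r, h r ^ q * h (r + s) := by
    rw [← integral_neg_eq_self]
    refine integral_congr_ae (Eventually.of_forall fun r => ?_)
    simp only
    rw [heven r, show -r - s = -(r + s) by ring, heven]
  have hsplit : ∫ r, h r ^ q * (h r - h (r + s) / 2 - h (r - s) / 2) =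
      (∫ r, h r ^ q * h r) - ∫ r, h r ^ q * h (r + s) := by
    have e : (fun r => h r ^ q * (h r - h (r + s) / 2 - h (r - s) / 2)) = fun r =>
        h r ^ q * h r - (h r ^ q * h (r + s) + h r ^ q * h (r - s)) * (1 / 2) := by
      ext r
      ring
    have i12 : Integrable fun r => h r ^ q * h (r + s) + h r ^ q * h (r - s) := i1.add i2
    rw [e, integral_sub i0 (i12.mul_const _), integral_mul_const, integral_add i1 i2, hsym]
    ring
  rw [← hsplit, mul_comm, ← integral_mul_const]
  refine integral_mono (integrable_rpow_mul_comp hq hc hs (by fun_prop)) i3 fun r => ?_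
  exact mul_le_mul_of_nonneg_left (by linarith [hM r s]) (rpow_nonneg (h0 r) q)

theorem exists_smooth_autocorrelation_sub_le {q δ : ℝ} (hq : 0 < q) (hδ : 0 < δ) :
    ∃ h : ℝ → ℝ, ContDiff ℝ (⊤ : ℕ∞) h ∧ HasCompactSupport h ∧ (∀ r, 0 ≤ h r) ∧
      0 < ∫ r, h r ^ q * h r ∧
      ∀ s, (∫ r, h r ^ q * h r) - ∫ r, h r ^ q * h (r + s) ≤
        δ * s ^ 2 * ∫ r, h r ^ q * h r := by
  let ψ : ContDiffBump (0 : ℝ) := default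
  obtain ⟨M, hM0, hM⟩ := exists_two_mul_sub_sub_le_mul_sq (ψ := ψ) ψ.contDiff ψ.hasCompactSupport
  have hA : 0 < ∫ r, ψ r ^ q * ψ r := by
    have i0 := integrable_rpow_mul_comp hq ψ.continuous ψ.hasCompactSupport ψ.continuous
    refine (integral_pos_iff_support_of_nonneg
      (fun r => mul_nonneg (rpow_nonneg ψ.nonneg q) ψ.nonneg) i0).2 ?_
    refine (Metric.measure_ball_pos volume (0 : ℝ) ψ.rOut_pos).trans_le (measure_mono fun r hr => ?_)
    have := ψ.pos_of_mem_ball hr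
    exact (by positivity : 0 < ψ r ^ q * ψ r).ne'
  have hB : 0 ≤ ∫ r, ψ r ^ q := integral_nonneg fun r => rpow_nonneg ψ.nonneg q
  set A := ∫ r, ψ r ^ q * ψ r
  set B := ∫ r, ψ r ^ q
  set ε := √(δ * A / (M / 2 * B + 1)) with hε
  have hden : 0 < M / 2 * B + 1 := by positivity
  have hε0 : 0 < ε := Real.sqrt_pos.2 (by positivity)
  have hε2 : ε ^ 2 * (M / 2 * B) ≤ δ * A := by
    have : ε ^ 2 * (M / 2 * B + 1) = δ * A := by
      rw [hε, Real.sq_sqrt (by positivity)]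
      field_simp
    nlinarith [sq_nonneg ε]
  have hcont : Continuous fun r => ψ (ε * r) := ψ.continuous.comp (by fun_prop)
  have hcs : HasCompactSupport fun r => ψ (ε * r) :=
    ψ.hasCompactSupport.comp_homeomorph (Homeomorph.mulLeft₀ ε hε0.ne')
  have hA' : ∫ r, ψ (ε * r) ^ q * ψ (ε * r) = ε⁻¹ * A := by
    rw [Measure.integral_comp_mul_left (fun r => ψ r ^ q * ψ r), abs_of_pos (by positivity),
      smul_eq_mul]
  have hB' : ∫ r, ψ (ε * r) ^ q = ε⁻¹ * B := by
    rw [Measure.integral_comp_mul_left (fun r => ψ r ^ q), abs_of_pos (by positivity), smul_eq_mul]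
  refine ⟨fun r => ψ (ε * r), ψ.contDiff.comp (by fun_prop), hcs, fun r => ψ.nonneg, ?_,
    fun s => ?_⟩
  · rw [hA']
    positivity
  · refine (integral_rpow_mul_sub_le (M := M * ε ^ 2) hq hcont hcs (fun r => ψ.nonneg)
      (fun r => by rw [mul_neg, ψ.neg]) (fun r s => ?_) s).trans ?_
    · have := hM (ε * r) (ε * s)
      rw [mul_add, mul_sub]
      linarith
    · rw [hA', hB']
      have : 0 ≤ s ^ 2 * ε⁻¹ := by positivity
      nlinarith [mul_le_mul_of_nonneg_left hε2 this]

open Set in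
theorem integral_Ioi_inv_mul_comp_log {G : ℝ → ℝ} (hG : Integrable G) :
    IntegrableOn (fun y => y⁻¹ * G (log y)) (Ioi 0) ∧
      ∫ y in Ioi (0 : ℝ), y⁻¹ * G (log y) = ∫ r, G r := by
  have himg : exp '' univ = Ioi 0 := by rw [image_univ, range_exp]
  have hder : ∀ x ∈ (univ : Set ℝ), HasDerivWithinAt exp (exp x) univ x :=
    fun x _ => (hasDerivAt_exp x).hasDerivWithinAt
  have e : ∀ x, |exp x| • ((exp x)⁻¹ * G (log (exp x))) = G x := by
    intro x
    rw [abs_of_pos (exp_pos x), log_exp, smul_eq_mul, mul_inv_cancel_left₀ (exp_pos x).ne']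
  rw [← himg]
  constructor
  · rw [integrableOn_image_iff_integrableOn_abs_deriv_smul MeasurableSet.univ hder
      exp_injective.injOn]
    simp_rw [e]
    exact hG.integrableOn
  · rw [integral_image_eq_integral_abs_deriv_smul MeasurableSet.univ hder exp_injective.injOn]
    simp_rw [e, setIntegral_univ]

open Set in
theorem lintegral_norm_rpow_mul_comp_log {d : ℕ} (hd : 0 < d) {G : ℝ → ℝ} (hG : Integrable G)
    (h0 : ∀ r, 0 ≤ G r) :
    ∫⁻ x : EuclideanSpace ℝ (Fin d), ENNReal.ofReal (‖x‖ ^ (-(d : ℝ)) * G (log ‖x‖)) =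
      ENNReal.ofReal (d * volume.real (Metric.ball (0 : EuclideanSpace ℝ (Fin d)) 1) *
        ∫ r, G r) := by
  have : Nontrivial (EuclideanSpace ℝ (Fin d)) := by
    refine Module.nontrivial_of_finrank_pos (R := ℝ) ?_
    rwa [finrank_euclideanSpace_fin]
  obtain ⟨hi, hv⟩ := integral_Ioi_inv_mul_comp_log hG
  have e : ∀ y ∈ Ioi (0 : ℝ), y⁻¹ * G (log y) = y ^ (d - 1) • (y ^ (-(d : ℝ)) * G (log y)) := by
    intro y hy
    have hy : 0 < y := hy
    rw [smul_eq_mul, ← mul_assoc]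
    congr 1
    rw [← rpow_natCast, ← rpow_add hy, ← rpow_neg_one, Nat.cast_sub hd]
    congr 1
    push_cast
    ring
  have hint : Integrable fun x : EuclideanSpace ℝ (Fin d) =>
      ‖x‖ ^ (-(d : ℝ)) * G (log ‖x‖) := by
    rw [integrable_fun_norm_addHaar volume (f := fun y => y ^ (-(d : ℝ)) * G (log y)),
      finrank_euclideanSpace_fin]
    exact hi.congr_fun e measurableSet_Ioi
  rw [← ofReal_integral_eq_lintegral_ofReal hint
    (Eventually.of_forall fun x => mul_nonneg (by positivity) (h0 _)),
    integral_fun_norm_addHaar volume (fun y => y ^ (-(d : ℝ)) * G (log y)),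
    finrank_euclideanSpace_fin, ← setIntegral_congr_fun measurableSet_Ioi e, hv]
  simp [mul_assoc]

theorem sq_mul_exp_neg_le_one_sub_exp_neg_sq {x : ℝ} (hx : 0 ≤ x) :
    x ^ 2 * exp (-x) ≤ (1 - exp (-x)) ^ 2 := by
  have h := self_le_sinh_iff.2 (by positivity : 0 ≤ x / 2)
  rw [sinh_eq] at h
  have e1 : exp (-x) = exp (-(x / 2)) ^ 2 := by rw [← exp_nat_mul]; congr 1; push_cast; ring
  have e2 : 1 - exp (-x) = exp (-(x / 2)) * (exp (x / 2) - exp (-(x / 2))) := by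
    rw [mul_sub, ← exp_add, ← exp_add]
    simp only [neg_add_cancel, exp_zero, ← neg_add, add_halves]
  rw [e2, e1, mul_pow, mul_comm]
  gcongr
  linarith

theorem log_sq_mul_add_rpow_neg_le {r β β' : ℝ} (hr : 0 < r) (hβ : 0 < β) (hββ' : β ≤ β') :
    β ^ 2 * (log r ^ 2 * (r ^ (-β) + r ^ (-β'))) ≤ 2 * ((1 - r ^ (-β)) * (1 - r ^ (-β'))) := by
  have key : ∀ r : ℝ, 1 ≤ r →
      β ^ 2 * (log r ^ 2 * (r ^ (-β) + r ^ (-β'))) ≤ 2 * ((1 - r ^ (-β)) * (1 - r ^ (-β'))) := by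
    intro r hr1
    have hr0 : 0 < r := by linarith
    have hlog := log_nonneg hr1
    have h := sq_mul_exp_neg_le_one_sub_exp_neg_sq (x := log r * β) (by positivity)
    rw [← mul_neg, ← rpow_def_of_pos hr0] at h
    have h1 : r ^ (-β') ≤ r ^ (-β) := rpow_le_rpow_of_exponent_le hr1 (by linarith)
    have h2 : r ^ (-β) ≤ 1 := rpow_le_one_of_one_le_of_nonpos hr1 (by linarith)
    nlinarith [mul_le_mul_of_nonneg_left h1 (by positivity : 0 ≤ (log r * β) ^ 2),
      mul_le_mul_of_nonneg_left h1 (sub_nonneg.2 h2)]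
  rcases le_total 1 r with h | h
  · exact key r h
  · have h1 := key r⁻¹ ((one_le_inv₀ hr).2 h)
    rw [log_inv, neg_sq, inv_rpow hr.le, inv_rpow hr.le, ← rpow_neg hr.le, ← rpow_neg hr.le,
      neg_neg, neg_neg] at h1
    have a0 : 0 < r ^ (-β) := rpow_pos_of_pos hr _
    have b0 : 0 < r ^ (-β') := rpow_pos_of_pos hr _
    have ea : r ^ β * r ^ (-β) = 1 := by rw [← rpow_add hr, add_neg_cancel, rpow_zero]
    have eb : r ^ β' * r ^ (-β') = 1 := by rw [← rpow_add hr, add_neg_cancel, rpow_zero]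
    generalize r ^ (-β) = a at a0 ea ⊢
    generalize r ^ (-β') = b at b0 eb ⊢
    generalize r ^ β = a' at h1 ea
    generalize r ^ β' = b' at h1 eb
    have h2 := mul_le_mul_of_nonneg_right h1 (mul_pos a0 b0).le
    calc _ = β ^ 2 * (log r ^ 2 * (a' * a * b + b' * b * a)) := by rw [ea, eb]; ring
      _ ≤ 2 * ((a - a' * a) * (b - b' * b)) := by linarith
      _ = _ := by rw [ea, eb]; ring

theorem integral_sub_mul_sub_rpow_le {q β β' δ l : ℝ} (hq : 0 < q) (hβ : 0 < β) (hββ' : β ≤ β')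
    (hδ : 0 ≤ δ) (hl : 0 < l) {h : ℝ → ℝ} (hc : Continuous h) (hs : HasCompactSupport h)
    (hA : 0 ≤ ∫ r, h r ^ q * h r)
    (hauto : ∀ s, (∫ r, h r ^ q * h r) - ∫ r, h r ^ q * h (r + s) ≤
      δ * s ^ 2 * ∫ r, h r ^ q * h r) :
    Integrable (fun r => (h r - l ^ (-β) * h (r + log l)) *
      (h r ^ q - l ^ (-β') * h (r + log l) ^ q)) ∧
    ∫ r, (h r - l ^ (-β) * h (r + log l)) * (h r ^ q - l ^ (-β') * h (r + log l) ^ q) ≤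
      (∫ r, h r ^ q * h r) * (1 + 2 * δ / β ^ 2) * ((1 - l ^ (-β)) * (1 - l ^ (-β'))) := by
  have hkey := log_sq_mul_add_rpow_neg_le hl hβ hββ'
  have ha : 0 < l ^ (-β) := rpow_pos_of_pos hl _
  have hb : 0 < l ^ (-β') := rpow_pos_of_pos hl _
  generalize l ^ (-β) = a at *
  generalize l ^ (-β') = b at *
  generalize log l = s at *
  have i0 := integrable_rpow_mul_comp hq hc hs hc
  have i1 := (integrable_rpow_mul_comp hq hc hs (k := fun r => h (r + s)) (by fun_prop))
  have i2 := (integrable_rpow_mul_comp hq hc hs (k := fun r => h (r + -s))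
    (by fun_prop)).comp_add_right s
  have i3 := i0.comp_add_right s
  have v2 := integral_add_right_eq_self (μ := volume) (fun r => h r ^ q * h (r + -s)) s
  have v3 := integral_add_right_eq_self (μ := volume) (fun r => h r ^ q * h r) s
  simp only [add_neg_cancel_right] at i2 v2
  have e : (fun r => (h r - a * h (r + s)) * (h r ^ q - b * h (r + s) ^ q)) = fun r =>
      (h r ^ q * h r - a * (h r ^ q * h (r + s))) -
        (b * (h (r + s) ^ q * h r) - a * b * (h (r + s) ^ q * h (r + s))) := by
    ext r
    ring
  have j1 : Integrable fun r => h r ^ q * h r - a * (h r ^ q * h (r + s)) :=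
    i0.sub (i1.const_mul a)
  have j2 : Integrable fun r =>
      b * (h (r + s) ^ q * h r) - a * b * (h (r + s) ^ q * h (r + s)) :=
    (i2.const_mul b).sub (i3.const_mul (a * b))
  rw [e]
  refine ⟨j1.sub j2, ?_⟩
  rw [integral_sub j1 j2, integral_sub i0 (i1.const_mul a),
    integral_sub (i2.const_mul b) (i3.const_mul (a * b)), integral_const_mul, integral_const_mul,
    integral_const_mul, v2, v3]
  have h1 := mul_le_mul_of_nonneg_left (hauto s) ha.le
  have h2 := mul_le_mul_of_nonneg_left (hauto (-s)) hb.le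
  rw [neg_sq] at h2
  have h3 : δ * s ^ 2 * (a + b) ≤ 2 * δ / β ^ 2 * ((1 - a) * (1 - b)) := by
    rw [div_mul_eq_mul_div, le_div_iff₀ (by positivity)]
    nlinarith [mul_le_mul_of_nonneg_left hkey hδ]
  nlinarith [mul_le_mul_of_nonneg_left h3 hA]

theorem lintegral_comp_smul_linearIsometryEquiv {d : ℕ} {c : ℝ} (hc : 0 < c)
    (R : EuclideanSpace ℝ (Fin d) ≃ₗᵢ[ℝ] EuclideanSpace ℝ (Fin d))
    (F : EuclideanSpace ℝ (Fin d) → ℝ≥0∞) :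
    ∫⁻ y, F y = ENNReal.ofReal (c ^ (d : ℝ)) * ∫⁻ z, F (c • R z) := by
  have h1 : ∫⁻ z, F (c • R z) = ∫⁻ w, F (c • w) :=
    R.measurePreserving.lintegral_comp_emb R.toHomeomorph.measurableEmbedding (fun w => F (c • w))
  have h2 : ∫⁻ w, F (c • w) = ENNReal.ofReal (|(c ^ d)⁻¹|) * ∫⁻ y, F y := by
    have h3 := Measure.map_addHaar_smul (volume : Measure (EuclideanSpace ℝ (Fin d))) hc.ne'
    rw [finrank_euclideanSpace_fin] at h3
    rw [← smul_eq_mul, ← lintegral_smul_measure, ← h3]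
    exact ((Homeomorph.smulOfNeZero c hc.ne').measurableEmbedding.lintegral_map F).symm
  rw [h1, h2, ← mul_assoc, ← ENNReal.ofReal_mul (by positivity), abs_of_pos (by positivity),
    rpow_natCast, mul_inv_cancel₀ (by positivity), ENNReal.ofReal_one, one_mul]

theorem exists_linearIsometryEquiv_norm_smul {d : ℕ} {e : EuclideanSpace ℝ (Fin d)} (he : ‖e‖ = 1)
    (x : EuclideanSpace ℝ (Fin d)) :
    ∃ R : EuclideanSpace ℝ (Fin d) ≃ₗᵢ[ℝ] EuclideanSpace ℝ (Fin d), ‖x‖ • R e = x := by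
  refine ⟨(ℝ ∙ (‖x‖ • e - x))ᗮ.reflection, ?_⟩
  rw [← map_smul, Submodule.reflection_sub]
  rw [norm_smul, norm_norm, he, mul_one]

theorem coefA_nonneg {d : ℕ} {α : ℝ} (hα0 : 0 < α) : 0 ≤ coefA d α := by
  have := Gamma_pos_of_pos (s := ((d : ℝ) + α) / 2) (by positivity)
  unfold coefA
  positivity

theorem nuK_nonneg {d : ℕ} {α : ℝ} (hα0 : 0 < α) (x y : EuclideanSpace ℝ (Fin d)) :
    0 ≤ nuK d α x y := mul_nonneg (coefA_nonneg hα0) (by positivity)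

theorem sgnPow_of_nonneg {a k : ℝ} (ha : 0 ≤ a) (hk : k ≠ 0) : sgnPow a k = a ^ k := by
  rcases ha.eq_or_lt with rfl | h
  · simp [sgnPow, zero_rpow hk]
  · simp [sgnPow, abs_of_pos h, Real.sign_of_pos h]

theorem lintegral_radial_sub_mul_sub_mul_nuK {d : ℕ} {α β β' q : ℝ} (hβ' : β' = q * β)
    (hsum : β + β' = d - α) {h : ℝ → ℝ} (h0 : ∀ r, 0 ≤ h r)
    {e x : EuclideanSpace ℝ (Fin d)} (he : ‖e‖ = 1) (hx : x ≠ 0) :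
    ∫⁻ y, ENNReal.ofReal ((‖x‖ ^ (-β) * h (log ‖x‖) - ‖y‖ ^ (-β) * h (log ‖y‖)) *
      ((‖x‖ ^ (-β) * h (log ‖x‖)) ^ q - (‖y‖ ^ (-β) * h (log ‖y‖)) ^ q) * nuK d α x y) =
    ∫⁻ z, ENNReal.ofReal (‖x‖ ^ (-(d : ℝ)) * ((h (log ‖x‖) - ‖z‖ ^ (-β) * h (log ‖x‖ + log ‖z‖)) *
      (h (log ‖x‖) ^ q - ‖z‖ ^ (-β') * h (log ‖x‖ + log ‖z‖) ^ q) * nuK d α e z)) := by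
  have hnt : Nontrivial (EuclideanSpace ℝ (Fin d)) := ⟨⟨x, 0, hx⟩⟩
  obtain ⟨R, hR⟩ := exists_linearIsometryEquiv_norm_smul he x
  have hc : 0 < ‖x‖ := norm_pos_iff.2 hx
  rw [lintegral_comp_smul_linearIsometryEquiv hc R, ← lintegral_const_mul' _ _ ENNReal.ofReal_ne_top]
  refine lintegral_congr_ae ?_
  filter_upwards [Measure.ae_ne volume (0 : EuclideanSpace ℝ (Fin d))] with z hz
  have hz0 : 0 < ‖z‖ := norm_pos_iff.2 hz
  have hν : nuK d α x (‖x‖ • R z) = ‖x‖ ^ (-(d : ℝ) - α) * nuK d α e z := by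
    have : ‖x - ‖x‖ • R z‖ = ‖x‖ * ‖e - z‖ := by
      calc ‖x - ‖x‖ • R z‖ = ‖‖x‖ • R (e - z)‖ := by rw [map_sub, smul_sub, hR]
        _ = ‖x‖ * ‖e - z‖ := by rw [norm_smul, norm_norm, R.norm_map]
    unfold nuK
    rw [this, mul_rpow (norm_nonneg _) (norm_nonneg _)]
    ring
  have hn : ‖‖x‖ • R z‖ = ‖x‖ * ‖z‖ := by rw [norm_smul, norm_norm, R.norm_map]
  rw [← ENNReal.ofReal_mul (by positivity), hν, hn, log_mul hc.ne' hz0.ne',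
    mul_rpow hc.le hz0.le, mul_rpow (by positivity) (h0 _), mul_rpow (by positivity) (h0 _),
    mul_rpow (by positivity) (by positivity), ← rpow_mul hc.le, ← rpow_mul hz0.le,
    show -β * q = -β' by rw [hβ']; ring]
  congr 1
  have hpow : ‖x‖ ^ (-(d : ℝ)) =
      ‖x‖ ^ (d : ℝ) * (‖x‖ ^ (-β) * ‖x‖ ^ (-β') * ‖x‖ ^ (-(d : ℝ) - α)) := by
    rw [← rpow_add hc, ← rpow_add hc, ← rpow_add hc]
    congr 1
    linarith
  rw [hpow]
  ring

theorem lintegral_lintegral_radial_le {d : ℕ} {α β β' q δ : ℝ} (hα0 : 0 < α) (hα2 : α < 2)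
    (hq : 0 < q) (hβ : 0 < β) (hββ' : β ≤ β') (hβ' : β' = q * β) (hsum : β + β' = d - α)
    (hδ : 0 ≤ δ) {h : ℝ → ℝ} (hc : Continuous h) (hs : HasCompactSupport h) (h0 : ∀ r, 0 ≤ h r)
    (hauto : ∀ s, (∫ r, h r ^ q * h r) - ∫ r, h r ^ q * h (r + s) ≤
      δ * s ^ 2 * ∫ r, h r ^ q * h r) :
    ∫⁻ x : EuclideanSpace ℝ (Fin d), ∫⁻ y : EuclideanSpace ℝ (Fin d),
      ENNReal.ofReal ((‖x‖ ^ (-β) * h (log ‖x‖) - ‖y‖ ^ (-β) * h (log ‖y‖)) *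
        ((‖x‖ ^ (-β) * h (log ‖x‖)) ^ q - (‖y‖ ^ (-β) * h (log ‖y‖)) ^ q) * nuK d α x y) ≤
    ENNReal.ofReal (d * volume.real (Metric.ball (0 : EuclideanSpace ℝ (Fin d)) 1) *
      (∫ r, h r ^ q * h r) * (1 + 2 * δ / β ^ 2) * (2 * kappaC d α β)) := by
  have hβ'0 : 0 < β' := hβ.trans_le hββ'
  have hd : 0 < d := by
    have : (0 : ℝ) < d := by linarith
    exact_mod_cast this
  let e : EuclideanSpace ℝ (Fin d) := EuclideanSpace.single ⟨0, hd⟩ 1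
  have he : ‖e‖ = 1 := by simp [e]
  have hnt : Nontrivial (EuclideanSpace ℝ (Fin d)) := ⟨⟨e, 0, by rintro h; simp [h] at he⟩⟩
  have hne0 : ∀ᵐ z : EuclideanSpace ℝ (Fin d), z ≠ 0 := Measure.ae_ne volume 0
  have hA : 0 ≤ ∫ r, h r ^ q * h r :=
    integral_nonneg fun r => mul_nonneg (rpow_nonneg (h0 r) q) (h0 r)
  have hm : Measurable h := hc.measurable
  rw [lintegral_congr_ae (hne0.mono fun x hx =>
    lintegral_radial_sub_mul_sub_mul_nuK hβ' hsum h0 he hx), lintegral_lintegral_swap]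
  swap
  · apply Measurable.aemeasurable
    unfold Function.uncurry nuK
    fun_prop
  set C := (d : ℝ) * volume.real (Metric.ball (0 : EuclideanSpace ℝ (Fin d)) 1) with hC
  have hC0 : 0 ≤ C := by positivity
  rw [ENNReal.ofReal_mul (by positivity), ← lintegral_one_sub_rpow_mul_nuK he hα0 hα2 hβ hβ'0 hsum,
    ← lintegral_const_mul' _ _ ENNReal.ofReal_ne_top]
  refine lintegral_mono_ae ?_
  filter_upwards [hne0] with z hz
  have hz0 : 0 < ‖z‖ := norm_pos_iff.2 hz
  obtain ⟨gi, gv⟩ := integral_sub_mul_sub_rpow_le hq hβ hββ' hδ hz0 hc hs hA hauto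
  have hnn : ∀ r, 0 ≤ (h r - ‖z‖ ^ (-β) * h (r + log ‖z‖)) *
      (h r ^ q - ‖z‖ ^ (-β') * h (r + log ‖z‖) ^ q) := by
    intro r
    have e1 : ‖z‖ ^ (-β') * h (r + log ‖z‖) ^ q = (‖z‖ ^ (-β) * h (r + log ‖z‖)) ^ q := by
      rw [mul_rpow (by positivity) (h0 _), ← rpow_mul hz0.le, hβ']
      congr 2
      ring
    rw [e1]
    have hb : 0 ≤ ‖z‖ ^ (-β) * h (r + log ‖z‖) := mul_nonneg (by positivity) (h0 _)
    rcases le_total (h r) (‖z‖ ^ (-β) * h (r + log ‖z‖)) with hle | hle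
    · exact mul_nonneg_of_nonpos_of_nonpos (sub_nonpos.2 hle)
        (sub_nonpos.2 (rpow_le_rpow (h0 r) hle hq.le))
    · exact mul_nonneg (sub_nonneg.2 hle) (sub_nonneg.2 (rpow_le_rpow hb hle hq.le))
  have hν := nuK_nonneg hα0 e z
  rw [lintegral_norm_rpow_mul_comp_log hd (G := fun r => (h r - ‖z‖ ^ (-β) * h (r + log ‖z‖)) *
      (h r ^ q - ‖z‖ ^ (-β') * h (r + log ‖z‖) ^ q) * nuK d α e z) (gi.mul_const _)
      (fun r => mul_nonneg (hnn r) hν), integral_mul_const, ← ENNReal.ofReal_mul (by positivity)]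
  refine ENNReal.ofReal_le_ofReal ?_
  have := mul_le_mul_of_nonneg_left (mul_le_mul_of_nonneg_right gv hν) hC0
  linarith

theorem exists_forall_comp_log_norm_eq_zero {E : Type*} [NormedAddCommGroup E] {h : ℝ → ℝ}
    (hs : HasCompactSupport h) :
    ∃ a b : ℝ, 0 < a ∧ ∀ x : E, x ≠ 0 → (‖x‖ < a ∨ b < ‖x‖) → h (log ‖x‖) = 0 := by
  obtain ⟨ρ, hρ⟩ := hs.isCompact.isBounded.subset_closedBall 0
  refine ⟨exp (-ρ), exp ρ, exp_pos _, fun x hx hab => ?_⟩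
  have hx0 : 0 < ‖x‖ := norm_pos_iff.2 hx
  by_contra hne
  have h1 := hρ (subset_tsupport h hne)
  rw [Metric.mem_closedBall, Real.dist_eq, sub_zero, abs_le] at h1
  rcases hab with h2 | h2
  · have := (log_lt_iff_lt_exp hx0).2 h2
    linarith
  · have := (lt_log_iff_exp_lt hx0).2 h2
    linarith

theorem contDiff_norm_rpow_mul_comp_log {E : Type*} [NormedAddCommGroup E] [InnerProductSpace ℝ E]
    {β : ℝ} (hβ : 0 < β) {h : ℝ → ℝ} (hc : ContDiff ℝ (⊤ : ℕ∞) h) (hs : HasCompactSupport h) :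
    ContDiff ℝ (⊤ : ℕ∞) (fun x : E => ‖x‖ ^ (-β) * h (log ‖x‖)) := by
  rw [contDiff_iff_contDiffAt]
  intro x
  by_cases hx : x = 0
  · obtain ⟨a, b, ha, hab⟩ := exists_forall_comp_log_norm_eq_zero (E := E) hs
    refine (contDiffAt_const (c := (0 : ℝ))).congr_of_eventuallyEq ?_
    filter_upwards [Metric.ball_mem_nhds x ha] with y hy
    rw [hx, mem_ball_zero_iff] at hy
    by_cases hy0 : y = 0
    · rw [hy0, norm_zero, zero_rpow (by linarith), zero_mul]
    · rw [hab y hy0 (Or.inl hy), mul_zero]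
  · have hn : ContDiffAt ℝ (⊤ : ℕ∞) (fun x : E => ‖x‖) x := contDiffAt_norm ℝ hx
    have hne : ‖x‖ ≠ 0 := norm_ne_zero_iff.2 hx
    exact (hn.rpow_const_of_ne hne).mul (hc.contDiffAt.comp x (hn.log hne))

theorem hasCompactSupport_norm_rpow_mul_comp_log {E : Type*} [NormedAddCommGroup E]
    [ProperSpace E] {β : ℝ} (hβ : 0 < β) {h : ℝ → ℝ} (hs : HasCompactSupport h) :
    HasCompactSupport (fun x : E => ‖x‖ ^ (-β) * h (log ‖x‖)) := by
  obtain ⟨a, b, ha, hab⟩ := exists_forall_comp_log_norm_eq_zero (E := E) hs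
  refine HasCompactSupport.intro (isCompact_closedBall (0 : E) b) fun x hx => ?_
  rw [mem_closedBall_zero_iff, not_le] at hx
  by_cases hx0 : x = 0
  · rw [hx0, norm_zero, zero_rpow (by linarith), zero_mul]
  · rw [hab x hx0 (Or.inr hx), mul_zero]

theorem hardyI_norm_rpow_mul_comp_log {d : ℕ} {α β p : ℝ} (hd : 0 < d) (hp : 1 < p)
    (hsum : p * β = d - α) {h : ℝ → ℝ} (hc : Continuous h) (hs : HasCompactSupport h)
    (h0 : ∀ r, 0 ≤ h r) :
    hardyI d α p (fun x => ‖x‖ ^ (-β) * h (log ‖x‖)) =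
      ENNReal.ofReal (d * volume.real (Metric.ball (0 : EuclideanSpace ℝ (Fin d)) 1) *
        ∫ r, h r ^ (p - 1) * h r) := by
  have hnt : Nontrivial (EuclideanSpace ℝ (Fin d)) := by
    refine Module.nontrivial_of_finrank_pos (R := ℝ) ?_
    rwa [finrank_euclideanSpace_fin]
  rw [← lintegral_norm_rpow_mul_comp_log hd
    (integrable_rpow_mul_comp (by linarith : 0 < p - 1) hc hs hc)
    fun r => mul_nonneg (rpow_nonneg (h0 r) _) (h0 r)]
  refine lintegral_congr_ae ?_
  filter_upwards [Measure.ae_ne volume (0 : EuclideanSpace ℝ (Fin d))] with x hx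
  have hx0 : 0 < ‖x‖ := norm_pos_iff.2 hx
  have e1 : h (log ‖x‖) ^ (p - 1) * h (log ‖x‖) = h (log ‖x‖) ^ p := by
    rw [← rpow_add_one' (h0 _) (by linarith), sub_add_cancel]
  rw [abs_of_nonneg (mul_nonneg (by positivity) (h0 _)), mul_rpow (by positivity) (h0 _),
    ← rpow_mul hx0.le, e1, mul_right_comm, ← rpow_add hx0]
  congr 3
  linarith

theorem formEp_norm_rpow_mul_comp_log_le {d : ℕ} {α β p δ : ℝ} (hα0 : 0 < α) (hα2 : α < 2)
    (hp : 2 ≤ p) (hβ : 0 < β) (hsum : p * β = d - α) (hδ : 0 ≤ δ) {h : ℝ → ℝ} (hc : Continuous h)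
    (hs : HasCompactSupport h) (h0 : ∀ r, 0 ≤ h r)
    (hauto : ∀ s, (∫ r, h r ^ (p - 1) * h r) - ∫ r, h r ^ (p - 1) * h (r + s) ≤
      δ * s ^ 2 * ∫ r, h r ^ (p - 1) * h r) :
    formEp d α p (fun x => ‖x‖ ^ (-β) * h (log ‖x‖)) ≤
      ENNReal.ofReal ((1 + 2 * δ / β ^ 2) * kappaC d α β) *
        hardyI d α p (fun x => ‖x‖ ^ (-β) * h (log ‖x‖)) := by
  have hd : (0 : ℝ) < d := by nlinarith
  have hA : 0 ≤ ∫ r, h r ^ (p - 1) * h r :=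
    integral_nonneg fun r => mul_nonneg (rpow_nonneg (h0 r) _) (h0 r)
  have hκ : 0 ≤ kappaC d α β := kappaC_nonneg hα0 hβ (by nlinarith)
  rw [hardyI_norm_rpow_mul_comp_log (by exact_mod_cast hd) (by linarith) hsum hc hs h0,
    ← ENNReal.ofReal_mul (by positivity)]
  unfold formEp
  have hf0 : ∀ x : EuclideanSpace ℝ (Fin d), 0 ≤ ‖x‖ ^ (-β) * h (log ‖x‖) :=
    fun x => mul_nonneg (by positivity) (h0 _)
  simp_rw [sgnPow_of_nonneg (hf0 _) (by linarith : p - 1 ≠ 0)]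
  have hle := lintegral_lintegral_radial_le (β' := (p - 1) * β) hα0 hα2 (by linarith : 0 < p - 1) hβ
    (by nlinarith) rfl (by linarith) hδ hc hs h0 hauto
  refine (mul_le_mul_right hle _).trans_eq ?_
  rw [show (1 / 2 : ℝ≥0∞) = ENNReal.ofReal (1 / 2) by
    rw [ENNReal.ofReal_div_of_pos two_pos]; simp, ← ENNReal.ofReal_mul (by norm_num)]
  congr 1
  ring

/-- For `p > 2` and any `κ > κ_{(d-α)/p}`, the reverse Hardy inequality
`E_p[f] < κ ∫ |f|^p |x|^{-α} dx < ∞` holds for some nonnegative `f ∈ C_c^∞(ℝ^d)`. -/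
theorem smooth_test_function_exists (d : ℕ) (α p κ : ℝ)
    (hα0 : 0 < α) (hαd : α < d) (hα2 : α < 2) (hp : 2 < p)
    (hκ : kappaC d α (((d : ℝ) - α) / p) < κ) :
    ∃ f : EuclideanSpace ℝ (Fin d) → ℝ, ContDiff ℝ (⊤ : ℕ∞) f ∧ HasCompactSupport f ∧
      (∀ x, 0 ≤ f x) ∧
      formEp d α p f < ENNReal.ofReal κ * hardyI d α p f ∧
      ENNReal.ofReal κ * hardyI d α p f < ⊤ := by
  set β := ((d : ℝ) - α) / p with hβdef
  have hβ : 0 < β := div_pos (by linarith) (by linarith)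
  have hsum : p * β = d - α := mul_div_cancel₀ _ (by linarith)
  have hd : 0 < d := by
    have : (0 : ℝ) < d := by linarith
    exact_mod_cast this
  have hκ0 : 0 ≤ kappaC d α β := kappaC_nonneg hα0 hβ (by nlinarith)
  obtain ⟨δ, hδ, hδκ⟩ : ∃ δ : ℝ, 0 < δ ∧ (1 + 2 * δ / β ^ 2) * kappaC d α β < κ := by
    refine ⟨β ^ 2 / 2 * ((κ - kappaC d α β) / (kappaC d α β + 1)), ?_, ?_⟩
    · have := sub_pos.2 hκ
      positivity
    · have e : 2 * (β ^ 2 / 2 * ((κ - kappaC d α β) / (kappaC d α β + 1))) / β ^ 2 =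
          (κ - kappaC d α β) / (kappaC d α β + 1) := by field_simp
      rw [e, add_mul, one_mul, div_mul_eq_mul_div, ← lt_sub_iff_add_lt', div_lt_iff₀ (by positivity)]
      nlinarith
  obtain ⟨h, hsm, hs, h0, hA, hauto⟩ :=
    exists_smooth_autocorrelation_sub_le (q := p - 1) (by linarith) hδ
  have hI := hardyI_norm_rpow_mul_comp_log hd (by linarith : 1 < p) hsum hsm.continuous hs h0
  have hC : 0 < volume.real (Metric.ball (0 : EuclideanSpace ℝ (Fin d)) 1) :=
    ENNReal.toReal_pos (Metric.measure_ball_pos _ _ one_pos).ne' measure_ball_lt_top.ne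
  refine ⟨fun x => ‖x‖ ^ (-β) * h (log ‖x‖), contDiff_norm_rpow_mul_comp_log hβ hsm hs,
    hasCompactSupport_norm_rpow_mul_comp_log hβ hs, fun x => mul_nonneg (by positivity) (h0 _),
    ?_, ?_⟩
  · refine (formEp_norm_rpow_mul_comp_log_le hα0 hα2 hp.le hβ hsum hδ.le hsm.continuous hs h0
      hauto).trans_lt ?_
    rw [hI]
    refine ENNReal.mul_lt_mul_left (ENNReal.ofReal_pos.2 (by positivity)).ne' ENNReal.ofReal_ne_top
      ((ENNReal.ofReal_lt_ofReal_iff (hκ0.trans_lt hκ)).2 hδκ)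
  · rw [hI]
    exact ENNReal.mul_lt_top ENNReal.ofReal_lt_top ENNReal.ofReal_lt_top
end
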